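/- arXiv:2410.15738 — 9 statements merged into one kernel-verified Lean document; each statement's English description precedes it below -/
import Mathlib

section
/- For every normalized instance of indivisible chore allocation with n agents, there exists an EQ1 allocation whose social cost is at most 1. In particular, since the minimum social cost over all allocations is nonnegative, the minimum social cost of an EQ1 allocation exceeds the minimum social cost of an arbitrary allocation by at most 1 (the cost of EQ1 is at most 1). -/
open Finset

/-- `A` is an allocation: the bundles are pairwise disjoint and every item is assigned. -/
def IsAllocation {n : ℕ} {ι : Type*} (A : Fin n → Finset ι) : Prop :=
  (∀ i j : Fin n, i ≠ j → Disjoint (A i) (A j)) ∧ ∀ o : ι, ∃ i : Fin n, o ∈ A i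

/-- The social cost of an allocation. -/
def SC {n : ℕ} {ι : Type*} (c : Fin n → ι → ℝ) (A : Fin n → Finset ι) : ℝ :=
  ∑ i, ∑ o ∈ A i, c i o

/-- Equitability up to one item. -/
def EQ1 {n : ℕ} {ι : Type*} [DecidableEq ι] (c : Fin n → ι → ℝ)
    (A : Fin n → Finset ι) : Prop :=
  ∀ i j : Fin n, ∃ S ⊆ A i, S.card ≤ 1 ∧ ∑ o ∈ A i \ S, c i o ≤ ∑ o ∈ A j, c j o

/-- The cost agent `i` bears when each item `o` is assigned to its owner `f o`. -/
def load {N ι : Type*} [DecidableEq N] [Fintype ι] (c : N → ι → ℝ) (f : ι → N) (i : N) : ℝ :=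
  ∑ o, if f o = i then c i o else 0

/-- Each item is owned by an agent minimizing `u i + a i o`; with `a i o = log (c i o)` this says
that `f` minimizes the social cost weighted by `exp (u i)`. -/
def IsOptimalAt {N ι : Type*} (a : N → ι → ℝ) (u : N → ℝ) (f : ι → N) : Prop :=
  ∀ o j, u (f o) + a (f o) o ≤ u j + a j o

section
variable {N ι : Type*}

theorem load_update [DecidableEq N] [Fintype ι] [DecidableEq ι] (c : N → ι → ℝ) (f : ι → N) (o : ι) (q i : N) :
    load c (Function.update f o q) i =
      load c f i - (if f o = i then c i o else 0) + (if q = i then c i o else 0) := by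
  unfold load
  rw [← Finset.add_sum_erase univ _ (mem_univ o),
    ← Finset.add_sum_erase univ (fun o => if f o = i then c i o else 0) (mem_univ o)]
  have : ∑ x ∈ univ.erase o, (if Function.update f o q x = i then c i x else 0) =
      ∑ x ∈ univ.erase o, (if f x = i then c i x else 0) := by
    refine sum_congr rfl fun x hx => ?_
    rw [Function.update_of_ne (ne_of_mem_erase hx)]
  rw [this, Function.update_self]
  ring

theorem IsOptimalAt.update [DecidableEq ι] {a : N → ι → ℝ} {u : N → ℝ} {f : ι → N} (hf : IsOptimalAt a u f)
    {o : ι} {q : N} (hq : u (f o) + a (f o) o = u q + a q o) :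
    IsOptimalAt a u (Function.update f o q) := by
  intro o' j
  rcases eq_or_ne o' o with rfl | h
  · rw [Function.update_self, ← hq]
    exact hf o' j
  · rw [Function.update_of_ne h]
    exact hf o' j

theorem exists_isOptimalAt [Finite N] [Nonempty N] (a : N → ι → ℝ) (u : N → ℝ) :
    ∃ f, IsOptimalAt a u f := by
  choose f hf using fun o => Finite.exists_min fun i => u i + a i o
  exact ⟨f, hf⟩

/-- Raising the potentials of a set of agents none of whose items is tied with an outside agent. -/
theorem IsOptimalAt.exists_raise [Finite N] [DecidableEq N] [Finite ι] {a : N → ι → ℝ} {u : N → ℝ} {f : ι → N} (hf : IsOptimalAt a u f)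
    (Z : Finset N) {M : ℝ} (hZM : ∀ z ∈ Z, u z < M)
    (hZ : ∀ o j, f o ∈ Z → j ∉ Z → u (f o) + a (f o) o ≠ u j + a j o) :
    ∃ ε > 0, (∀ z ∈ Z, u z + ε ≤ M) ∧
      IsOptimalAt a (fun i => if i ∈ Z then u i + ε else u i) f := by
  have h1 : ∀ z : N, ∀ᶠ ε in nhdsWithin (0 : ℝ) (Set.Ioi 0), z ∈ Z → u z + ε ≤ M := by
    intro z
    by_cases hz : z ∈ Z
    · filter_upwards [Ioo_mem_nhdsGT (sub_pos.2 (hZM z hz))] with ε hε _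
      linarith [hε.2]
    · exact Filter.Eventually.of_forall fun _ h => absurd h hz
  have h2 : ∀ o j, ∀ᶠ ε in nhdsWithin (0 : ℝ) (Set.Ioi 0), f o ∈ Z → j ∉ Z →
      u (f o) + ε + a (f o) o ≤ u j + a j o := by
    intro o j
    by_cases ho : f o ∈ Z ∧ j ∉ Z
    · have := lt_of_le_of_ne (hf o j) (hZ o j ho.1 ho.2)
      filter_upwards [Ioo_mem_nhdsGT (sub_pos.2 this)] with ε hε _ _
      linarith [hε.2]
    · exact Filter.Eventually.of_forall fun _ h h' => absurd ⟨h, h'⟩ ho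
  obtain ⟨ε, ⟨hε1, hε2⟩, hε⟩ := (((Filter.eventually_all.2 h1).and
    (Filter.eventually_all.2 fun o => Filter.eventually_all.2 (h2 o))).and
      self_mem_nhdsWithin).exists
  have hpos : 0 < ε := hε
  refine ⟨ε, hpos, hε1, fun o j => ?_⟩
  have := hf o j
  by_cases h : f o ∈ Z <;> by_cases h' : j ∈ Z <;> simp only [h, h', if_true, if_false]
  · linarith
  · exact hε2 o j h h'
  · linarith
  · exact this

/-- Among the optimal assignments, one can maximize the least load `T`, and then the number of
agents with load above `T`. -/
theorem exists_maximin [Fintype N] [DecidableEq N] [Fintype ι] [Nonempty N] (c a : N → ι → ℝ) :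
    ∃ (u : N → ℝ) (f : ι → N) (T : ℝ) (p : N), IsOptimalAt a u f ∧ (∀ i, T ≤ load c f i) ∧
      load c f p = T ∧ ∀ u' f', IsOptimalAt a u' f' → (∀ i, T ≤ load c f' i) →
        #{i | T < load c f' i} ≤ #{i | T < load c f i} := by
  classical
  choose m hm using fun f => Finite.exists_min (load c f)
  obtain ⟨f₀, hf₀⟩ := exists_isOptimalAt a 0
  obtain ⟨g, ⟨v, hv⟩, hg⟩ := Set.exists_max_image {f | ∃ u, IsOptimalAt a u f}
    (fun f => load c f (m f)) (Set.toFinite _) ⟨f₀, 0, hf₀⟩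
  set T := load c g (m g)
  obtain ⟨f, ⟨⟨u, hu⟩, hT⟩, hf⟩ := Set.exists_max_image
    {f | (∃ u, IsOptimalAt a u f) ∧ ∀ i, T ≤ load c f i}
    (fun f => #{i | T < load c f i}) (Set.toFinite _) ⟨g, ⟨v, hv⟩, hm g⟩
  exact ⟨u, f, T, m f, hu, hT, le_antisymm (hg f ⟨u, hu⟩) (hT _),
    fun u' f' h h' => hf f' ⟨⟨u', h⟩, h'⟩⟩

/-- If an assignment and level function maximize `(|ι| + 1) ∑ L - ∑ L ∘ f` among those in which
levels drop by at most one along ties, then every agent of positive, non-maximal level owns an item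
whose transfer to a tied agent would leave the class `P` of assignments. -/
theorem exists_levels [Fintype N] [Fintype ι] [DecidableEq ι] (a : N → ι → ℝ) (u : N → ℝ) (p : N) (n : ℕ) (P : (ι → N) → Prop)
    (hP : ∃ f, P f) :
    ∃ (f : ι → N) (L : N → ℕ), P f ∧ L p = 0 ∧ (∀ i, L i ≤ n) ∧
      (∀ o q, u (f o) + a (f o) o = u q + a q o → L (f o) ≤ L q + 1) ∧
      ∀ h, h ≠ p → L h < n → ∃ o q, f o = h ∧ q ≠ h ∧
        u h + a h o = u q + a q o ∧ ¬ P (Function.update f o q) := by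
  classical
  obtain ⟨f₀, hf₀⟩ := hP
  obtain ⟨⟨f, L⟩, ⟨hf, hp, hL⟩, hmax⟩ := Set.exists_max_image
    {x : (ι → N) × (N → Fin (n + 1)) | P x.1 ∧ (x.2 p : ℕ) = 0 ∧
      ∀ o q, u (x.1 o) + a (x.1 o) o = u q + a q o → (x.2 (x.1 o) : ℕ) ≤ x.2 q + 1}
    (fun x => ((Fintype.card ι : ℤ) + 1) * ∑ i, ((x.2 i : ℕ) : ℤ) - ∑ o, ((x.2 (x.1 o) : ℕ) : ℤ))
    (Set.toFinite _) ⟨(f₀, fun _ => 0), hf₀, by simp, by simp⟩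
  refine ⟨f, fun i => L i, hf, hp, fun i => Nat.lt_succ_iff.1 (L i).2, hL, fun h hh hn => ?_⟩
  replace hn : (L h : ℕ) < n := hn
  have key : ∃ o q, f o = h ∧ u h + a h o = u q + a q o ∧ (L h : ℕ) = L q + 1 := by
    by_contra! hcon
    let L' : N → Fin (n + 1) := Function.update L h ⟨L h + 1, by omega⟩
    have hL'h : (L' h : ℕ) = L h + 1 := by simp [L']
    have hL' : ∀ i, i ≠ h → L' i = L i := fun i hi => by simp [L', hi]
    have hge : ∀ i, (L i : ℕ) ≤ L' i := fun i => by
      rcases eq_or_ne i h with rfl | hi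
      · omega
      · rw [hL' i hi]
    have hle : ∀ i, (L' i : ℕ) ≤ L i + 1 := fun i => by
      rcases eq_or_ne i h with rfl | hi
      · omega
      · rw [hL' i hi]; omega
    have hmem : P f ∧ (L' p : ℕ) = 0 ∧
        ∀ o q, u (f o) + a (f o) o = u q + a q o → (L' (f o) : ℕ) ≤ L' q + 1 := by
      refine ⟨hf, by rw [hL' p hh.symm]; exact hp, fun o q ht => ?_⟩
      have h1 := hL o q ht
      have h2 := hge q
      simp only at h1
      rcases eq_or_ne (f o) h with ho | ho
      · subst ho
        have := hcon o q rfl ht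
        omega
      · rw [hL' _ ho]; omega
    have h1 := hmax (f, L') hmem
    simp only at h1
    have h2 : ∑ i, ((L' i : ℕ) : ℤ) = ∑ i, ((L i : ℕ) : ℤ) + 1 := by
      rw [← Finset.add_sum_erase univ _ (mem_univ h),
        ← Finset.add_sum_erase univ (fun i => ((L i : ℕ) : ℤ)) (mem_univ h),
        sum_congr rfl fun i hi => by rw [hL' i (ne_of_mem_erase hi)], hL'h]
      push_cast
      ring
    have h3 : ∑ o, ((L' (f o) : ℕ) : ℤ) ≤ ∑ o, ((L (f o) : ℕ) : ℤ) + Fintype.card ι := by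
      calc ∑ o, ((L' (f o) : ℕ) : ℤ) ≤ ∑ o, (((L (f o) : ℕ) : ℤ) + 1) :=
            sum_le_sum fun o _ => by exact_mod_cast hle (f o)
        _ = _ := by simp [sum_add_distrib]
    rw [h2] at h1
    linarith
  obtain ⟨o, q, ho, ht, hlq⟩ := key
  refine ⟨o, q, ho, by rintro rfl; omega, ht, fun hP' => ?_⟩
  have hmem : P (Function.update f o q) ∧ (L p : ℕ) = 0 ∧
      ∀ o' q', u (Function.update f o q o') + a (Function.update f o q o') o' = u q' + a q' o' →
        (L (Function.update f o q o') : ℕ) ≤ L q' + 1 := by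
    refine ⟨hP', hp, fun o' q' ht' => ?_⟩
    rcases eq_or_ne o' o with rfl | hne
    · rw [Function.update_self] at ht' ⊢
      have : (L (f o') : ℕ) ≤ L q' + 1 := hL o' q' (by rw [← ht', ← ht, ← ho])
      rw [ho] at this
      omega
    · rw [Function.update_of_ne hne] at ht' ⊢
      exact hL o' q' ht'
  have h1 := hmax (Function.update f o q, L) hmem
  simp only at h1
  have h2 : ∑ o', ((L (Function.update f o q o') : ℕ) : ℤ) < ∑ o', ((L (f o') : ℕ) : ℤ) := by
    refine sum_lt_sum (fun o' _ => ?_) ⟨o, mem_univ o, ?_⟩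
    · rcases eq_or_ne o' o with rfl | hne
      · rw [Function.update_self, ho]
        exact_mod_cast (by omega : (L q : ℕ) ≤ L h)
      · rw [Function.update_of_ne hne]
    · rw [Function.update_self, ho]
      exact_mod_cast (by omega : (L q : ℕ) < L h)
  linarith

/-- With positive costs there is an assignment that is optimal for some potentials and equitable up
to one item, with threshold `T`. -/
theorem exists_isOptimalAt_equitable [Fintype N] [DecidableEq N] [Fintype ι] [Nonempty N] (c a : N → ι → ℝ) (hc : ∀ i o, 0 < c i o) :
    ∃ (u : N → ℝ) (f : ι → N) (T : ℝ), IsOptimalAt a u f ∧ (∀ i, T ≤ load c f i) ∧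
      ∀ i, load c f i ≤ T ∨ ∃ o, f o = i ∧ load c f i - c i o ≤ T := by
  classical
  obtain ⟨u₁, f₁, T, p, hu₁, hT₁, hp₁, hmax⟩ := exists_maximin c a
  let P : (ι → N) → Prop := fun f => (∀ i, T ≤ load c f i) ∧ load c f p = T ∧
    #{i | T < load c f₁ i} ≤ #{i | T < load c f i}
  obtain ⟨M, hM₁, hM₂⟩ : ∃ M : ℝ, (∀ i, |u₁ i - u₁ p| ≤ M) ∧ ∀ i o, a p o - a i o < M := by
    obtain ⟨M₁, h₁⟩ := (Set.finite_range fun i => |u₁ i - u₁ p|).bddAbove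
    obtain ⟨M₂, h₂⟩ := (Set.finite_range fun x : N × ι => a p x.2 - a x.1 x.2).bddAbove
    refine ⟨max M₁ (M₂ + 1), fun i => (h₁ ⟨i, rfl⟩).trans (le_max_left _ _), fun i o => ?_⟩
    have := h₂ ⟨(i, o), rfl⟩
    simp only at this
    exact lt_of_lt_of_le (by linarith) (le_max_right M₁ (M₂ + 1))
  let K : (ι → N) → Set (N → ℝ) := fun f =>
    Set.Icc (fun _ => -M) (fun _ => M) ∩ {u | u p = 0 ∧ IsOptimalAt a u f}
  have hK : IsCompact (⋃ f ∈ {f | P f}, K f) := by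
    refine (Set.toFinite _).isCompact_biUnion fun f _ => isCompact_Icc.inter_right ?_
    refine (isClosed_eq (continuous_apply p) continuous_const).inter ?_
    have : {u | IsOptimalAt a u f} = ⋂ o, ⋂ j, {u | u (f o) + a (f o) o ≤ u j + a j o} := by
      ext
      simp [IsOptimalAt]
    change IsClosed {u | IsOptimalAt a u f}
    rw [this]
    exact isClosed_iInter fun o => isClosed_iInter fun j =>
      isClosed_le (by fun_prop) (by fun_prop)
  obtain ⟨u, hu, humax⟩ := hK.exists_isMaxOn (f := fun u => ∑ i, u i)
    ⟨fun i => u₁ i - u₁ p, Set.mem_biUnion (x := f₁) ⟨hT₁, hp₁, le_rfl⟩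
      ⟨⟨fun i => (abs_le.1 (hM₁ i)).1, fun i => (abs_le.1 (hM₁ i)).2⟩, by simp,
        fun o j => by linarith [hu₁ o j]⟩⟩ (by fun_prop)
  obtain ⟨g, hgP, ⟨huM, huM'⟩, hup, hug⟩ : ∃ g, P g ∧ u ∈ K g := by simpa using hu
  obtain ⟨f, L, ⟨hfP, huf⟩, hLp, hLn, hL, hstep⟩ := exists_levels a u p (Fintype.card N)
    (fun f => P f ∧ IsOptimalAt a u f) ⟨g, hgP, hug⟩
  obtain ⟨k, hk, hkL⟩ : ∃ k ≤ Fintype.card N, ∀ i, L i ≠ k := by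
    by_contra! hcon
    have : range (Fintype.card N + 1) ⊆ univ.image L := fun k hk => by
      obtain ⟨i, hi⟩ := hcon k (by simpa [Nat.lt_succ_iff] using hk)
      exact mem_image.2 ⟨i, mem_univ i, hi⟩
    have := (card_le_card this).trans card_image_le
    simp at this
  have hZ : ∀ i, k < L i → u i = M := by
    by_contra! hcon
    obtain ⟨z, hz, hzM⟩ := hcon
    obtain ⟨ε, hε, hεM, hopt⟩ := huf.exists_raise {i | k < L i ∧ u i < M} (M := M)
      (fun z hz => by simp at hz; exact hz.2) (fun o j ho hj ht => by
        simp only [mem_filter, mem_univ, true_and, not_and, not_lt] at ho hj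
        have h1 := hL o j ht
        have h2 := hj (lt_of_le_of_ne (by omega) (hkL j).symm)
        have h3 := huf o p
        have h4 := hM₂ j o
        linarith)
    have hmem : (fun i => if i ∈ ({i | k < L i ∧ u i < M} : Finset N) then u i + ε else u i) ∈
        ⋃ f ∈ {f | P f}, K f := by
      refine Set.mem_biUnion (x := f) hfP ⟨⟨fun i => ?_, fun i => ?_⟩, ?_, hopt⟩
      · have := huM i
        simp only at this ⊢
        split_ifs <;> linarith
      · have := huM' i
        simp only at this ⊢
        split_ifs with h
        · exact hεM i h
        · exact this
      · simp [hLp, hup]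
    refine absurd (isMaxOn_iff.1 humax _ hmem)
      (not_le.2 (sum_lt_sum (fun i _ => ?_) ⟨z, mem_univ z, ?_⟩))
    · split_ifs <;> linarith
    · rw [if_pos (by simpa using ⟨hz, lt_of_le_of_ne (huM' z) hzM⟩)]
      linarith
  refine ⟨u, f, T, huf, hfP.1, fun h => ?_⟩
  rcases lt_or_gt_of_ne (hkL h) with hlt | hgt
  · rcases eq_or_ne h p with rfl | hhp
    · exact Or.inl hfP.2.1.le
    obtain ⟨o, q, ho, hqh, ht, hnP⟩ := hstep h hhp (by omega)
    refine Or.inr ⟨o, ho, ?_⟩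
    by_contra! hcon
    subst ho
    have hopt := huf.update ht
    have hh : load c (Function.update f o q) (f o) = load c f (f o) - c (f o) o := by
      simp [load_update, hqh]
    have hq : load c (Function.update f o q) q = load c f q + c q o := by
      simp [load_update, hqh.symm]
    have hi : ∀ i, i ≠ f o → i ≠ q → load c (Function.update f o q) i = load c f i := by
      intro i h1 h2
      simp [load_update, h1.symm, h2.symm]
    have hle : ∀ i, T ≤ load c (Function.update f o q) i := by
      intro i
      have h1 := hfP.1 i
      by_cases h2 : i = f o
      · subst h2; linarith
      by_cases h3 : i = q
      · subst h3; linarith [hc i o]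
      rw [hi i h2 h3]; exact h1
    have hsub : ({i | T < load c f i} : Finset N) ⊆
        ({i | T < load c (Function.update f o q) i} : Finset N) := by
      intro i hi'
      simp only [mem_filter, mem_univ, true_and] at hi' ⊢
      by_cases h2 : i = f o
      · subst h2; linarith
      by_cases h3 : i = q
      · subst h3; linarith [hc i o]
      rw [hi i h2 h3]; exact hi'
    rcases eq_or_ne q p with rfl | hqp
    · have hss : ({i | T < load c f i} : Finset N) ⊂
          ({i | T < load c (Function.update f o q) i} : Finset N) := by
        refine (ssubset_iff_of_subset hsub).2 ⟨q, ?_, ?_⟩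
        · simp only [mem_filter, mem_univ, true_and]
          linarith [hc q o, hfP.1 q]
        · simp [hfP.2.1]
      have h1 := card_lt_card hss
      have h2 := hmax u _ hopt hle
      have h3 := hfP.2.2
      omega
    · exact hnP ⟨⟨hle, by rw [hi p hhp.symm hqp.symm]; exact hfP.2.1,
        hfP.2.2.trans (card_le_card hsub)⟩, hopt⟩
  · left
    have hne : ∀ o, f o ≠ h := by
      rintro o rfl
      linarith [huf o p, hM₂ (f o) o, hZ _ hgt]
    have : load c f h = 0 := by simp [load, hne]
    have h1 := hfP.1 h
    have h2 : 0 ≤ load c f p := sum_nonneg fun o _ => by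
      split_ifs
      exacts [(hc p o).le, le_rfl]
    rw [this, ← hfP.2.1]
    exact h2

/-- With nonnegative costs there is an assignment equitable up to one item in which some agent `l`
would bear at least the cost of each item's owner. -/
theorem exists_equitable_le [Fintype N] [DecidableEq N] [Fintype ι] [Nonempty N] (c : N → ι → ℝ) (hc : ∀ i o, 0 ≤ c i o) :
    ∃ (f : ι → N) (l : N) (T : ℝ), (∀ o, c (f o) o ≤ c l o) ∧ (∀ i, T ≤ load c f i) ∧
      ∀ i, load c f i ≤ T ∨ ∃ o, f o = i ∧ load c f i - c i o ≤ T := by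
  classical
  let p : ι → Prop := fun o => ∀ i, 0 < c i o
  obtain ⟨u, g, T, hg, hT, hE⟩ := exists_isOptimalAt_equitable
    (fun i (o : {o // p o}) => c i o) (fun i o => Real.log (c i o)) (fun i o => o.2 i)
  obtain ⟨l, hl⟩ := Finite.exists_min u
  have hz : ∀ o : {o // ¬ p o}, ∃ i, c i o = 0 := fun o => by
    obtain ⟨i, hi⟩ := not_forall.1 o.2
    exact ⟨i, le_antisymm (not_lt.1 hi) (hc i o)⟩
  choose z hz using hz
  let f : ι → N := fun o => if h : p o then g ⟨o, h⟩ else z ⟨o, h⟩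
  have hf₁ : ∀ o : {o // p o}, f o = g o := fun o => dif_pos o.2
  have hf₂ : ∀ o : {o // ¬ p o}, f o = z o := fun o => dif_neg o.2
  have hload : ∀ i, load c f i = load (fun i (o : {o // p o}) => c i o) g i := by
    intro i
    unfold load
    rw [← Fintype.sum_subtype_add_sum_subtype p]
    have : ∑ o : {o // ¬ p o}, (if f o = i then c i o else 0) = 0 := by
      refine sum_eq_zero fun o _ => ?_
      split_ifs with h
      · rw [← h, hf₂, hz]
      · rfl
    rw [this, add_zero]
    exact sum_congr rfl fun o _ => by rw [hf₁]
  refine ⟨f, l, T, fun o => ?_, fun i => (hload i).symm ▸ hT i, fun i => ?_⟩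
  · by_cases h : p o
    · have h1 := hg ⟨o, h⟩ l
      have h2 := hl (g ⟨o, h⟩)
      rw [hf₁ ⟨o, h⟩]
      exact (Real.log_le_log_iff (h _) (h _)).1 (by simp only at h1; linarith)
    · rw [hf₂ ⟨o, h⟩, hz ⟨o, h⟩]
      exact hc l o
  · rw [hload]
    refine (hE i).imp id ?_
    rintro ⟨o, ho, h⟩
    exact ⟨o, (hf₁ o).trans ho, h⟩

end

/-- For every normalized chore instance there is an EQ1 allocation of social cost at most 1;
in particular its social cost exceeds that of any allocation by at most 1. -/
theorem eq1_social_cost_at_most_one (n : ℕ) (hn : 1 ≤ n) (ι : Type*) [Fintype ι]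
    [DecidableEq ι] (c : Fin n → ι → ℝ) (hnonneg : ∀ i o, 0 ≤ c i o)
    (hnorm : ∀ i, ∑ o, c i o = 1) :
    ∃ A : Fin n → Finset ι, IsAllocation A ∧ EQ1 c A ∧ SC c A ≤ 1 ∧
      ∀ B : Fin n → Finset ι, IsAllocation B → SC c A ≤ SC c B + 1 := by
  have : Nonempty (Fin n) := ⟨⟨0, hn⟩⟩
  obtain ⟨f, l, T, hl, hT, hE⟩ := exists_equitable_le c hnonneg
  have hload : ∀ i, ∑ o with f o = i, c i o = load c f i := fun i => sum_filter _ _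
  have hSC : SC c (fun i => ({o | f o = i} : Finset ι)) ≤ 1 := by
    calc SC c (fun i => ({o | f o = i} : Finset ι)) = ∑ o, c (f o) o := by
          simp only [SC, sum_filter]
          rw [sum_comm]
          simp
      _ ≤ ∑ o, c l o := sum_le_sum fun o _ => hl o
      _ = 1 := hnorm l
  refine ⟨fun i => {o | f o = i}, ⟨fun i j hij => ?_, fun o => ⟨f o, by simp⟩⟩,
    fun i j => ?_, hSC, fun B _ => ?_⟩
  · refine disjoint_left.2 fun o hi hj => hij ?_
    simp only [mem_filter, mem_univ, true_and] at hi hj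
    exact hi.symm.trans hj
  · simp only [hload]
    rcases hE i with h | ⟨o, ho, h⟩
    · exact ⟨∅, empty_subset _, by simp, by rw [sdiff_empty, hload]; exact h.trans (hT j)⟩
    · have hsub : ({o} : Finset ι) ⊆ ({o | f o = i} : Finset ι) := by simpa using ho
      refine ⟨{o}, hsub, by simp, ?_⟩
      have := sum_sdiff (f := c i) hsub
      rw [hload, sum_singleton] at this
      linarith [hT j]
  · have : 0 ≤ SC c B := sum_nonneg fun i _ => sum_nonneg fun o _ => hnonneg i o
    linarith
end

section
/- For every integer n ≥ 2 and every real δ > 0, there exists a normalized instance of indivisible chore allocation with n agents in which some allocation has social cost at most δ, while every EQ1 allocation has social cost at least (n−1)/n. Consequently, the cost of EQ1 — the supremum over instances of the minimum social cost of an EQ1 allocation minus the minimum social cost of an arbitrary allocation — is at least 1 − 1/n. -/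
open Finset

/-- If every item other than `none` costs `a` and `none` is free, a bundle costs `a` times its
number of items other than `none`. -/
theorem sum_ite_ne_none {α : Type*} [DecidableEq α] (s : Finset (Option α)) (a : ℝ) :
    ∑ o ∈ s, (if o ≠ none then a else 0) = (#{o ∈ s | o ≠ none} : ℝ) * a := by
  rw [← Finset.sum_filter, Finset.sum_const, nsmul_eq_mul]

/-- The bundles of an allocation of `Option α` together hold `card α` items other than `none`. -/
theorem IsAllocation.sum_card_ne_none {n : ℕ} {α : Type*} [Fintype α] [DecidableEq α]
    {B : Fin n → Finset (Option α)} (hB : IsAllocation B) :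
    ∑ i, #{o ∈ B i | o ≠ none} = Fintype.card α := by
  have hunion : (univ.biUnion fun i => {o ∈ B i | o ≠ none}) = univ.erase (none : Option α) := by
    ext o
    have := hB.2 o
    simp [this]
  rw [← card_biUnion fun i _ j _ hij => disjoint_filter_filter (hB.1 i j hij), hunion,
    card_erase_of_mem (mem_univ _), card_univ, Fintype.card_option, Nat.add_sub_cancel]

/-- The item `none` is free for every agent but `l`, to whom it costs `1 - n * ε`; every other
item costs `ε` to `l` and `1 / n` to the other agents. -/
noncomputable def badCost {n : ℕ} (l : Fin n) (ε : ℝ) (i : Fin n) (o : Option (Fin n)) : ℝ :=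
  if i = l then (if o ≠ none then ε else 1 - n * ε) else (if o ≠ none then 1 / n else 0)

section badCost

variable {n : ℕ} {l : Fin n} {ε : ℝ}

theorem badCost_nonneg (hε : 0 ≤ ε) (hn : n * ε ≤ 1) (i : Fin n) (o : Option (Fin n)) :
    0 ≤ badCost l ε i o := by
  have : 0 ≤ 1 - n * ε := by linarith
  unfold badCost
  split_ifs <;> positivity

theorem sum_badCost (i : Fin n) : ∑ o, badCost l ε i o = 1 := by
  have hn : (n : ℝ) ≠ 0 := Nat.cast_ne_zero.2 (Fin.pos l).ne'
  rw [Fintype.sum_option]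
  by_cases h : i = l <;> simp [badCost, h, hn]

theorem sum_badCost_of_ne {i : Fin n} (hi : i ≠ l) (s : Finset (Option (Fin n))) :
    ∑ o ∈ s, badCost l ε i o = (#{o ∈ s | o ≠ none} : ℝ) * (1 / n) := by
  simp only [badCost, if_neg hi, sum_ite_ne_none]

theorem exists_isAllocation_SC_badCost {k : Fin n} (hk : k ≠ l) :
    ∃ A : Fin n → Finset (Option (Fin n)), IsAllocation A ∧ SC (badCost l ε) A = n * ε := by
  refine ⟨fun i => if i = l then univ.erase none else if i = k then {none} else ∅,
    ⟨fun i j hij => ?_, fun o => ?_⟩, ?_⟩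
  · rw [Finset.disjoint_left]
    intro o hi hj
    grind
  · by_cases ho : o = none
    · exact ⟨k, by simp [hk, ho]⟩
    · exact ⟨l, by simp [ho]⟩
  · rw [SC, Finset.sum_eq_single l]
    · have := sum_badCost (l := l) (ε := ε) l
      rw [← Finset.add_sum_erase _ _ (mem_univ none)] at this
      simp only [if_pos]
      simp only [badCost, if_pos, ne_eq, not_true_eq_false, if_false] at this ⊢
      linarith
    · intro i _ hi
      by_cases h : i = k <;> simp [h, hk, hi, badCost]
    · simp

/-- In an EQ1 allocation agent `l` receives at most one item other than `none`: otherwise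
every other agent would need a positive cost, hence one of the remaining `n - 2` such items. -/
theorem EQ1.card_ne_none_le_one (hε : 0 < ε) (hn : n * ε ≤ 1)
    {B : Fin n → Finset (Option (Fin n))} (hB : IsAllocation B) (hE : EQ1 (badCost l ε) B) :
    #{o ∈ B l | o ≠ none} ≤ 1 := by
  by_contra! h
  have hpos : ∀ i ≠ l, 1 ≤ #{o ∈ B i | o ≠ none} := by
    intro i hi
    obtain ⟨S, -, hS, hle⟩ := hE l i
    obtain ⟨o, ho, hoS⟩ := Finset.exists_mem_notMem_of_card_lt_card (hS.trans_lt h)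
    rw [mem_filter] at ho
    have hlow := Finset.single_le_sum (fun x _ => badCost_nonneg (l := l) hε.le hn l x)
      (mem_sdiff.2 ⟨ho.1, hoS⟩)
    have hval : badCost l ε l o = ε := by simp [badCost, ho.2]
    rw [sum_badCost_of_ne hi] at hle
    by_contra! h0
    rw [Nat.lt_one_iff.1 h0, Nat.cast_zero, zero_mul] at hle
    linarith
  have hsum := hB.sum_card_ne_none
  rw [← Finset.add_sum_erase _ _ (mem_univ l), Fintype.card_fin] at hsum
  have hrest := Finset.card_nsmul_le_sum (univ.erase l) (fun i => #{o ∈ B i | o ≠ none}) 1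
    fun i hi => hpos i (ne_of_mem_erase hi)
  rw [card_erase_of_mem (mem_univ l), card_univ, Fintype.card_fin, smul_eq_mul] at hrest
  omega

theorem EQ1.le_SC_badCost (hε : 0 < ε) (hn : n * ε ≤ 1)
    {B : Fin n → Finset (Option (Fin n))} (hB : IsAllocation B) (hE : EQ1 (badCost l ε) B) :
    ((n : ℝ) - 1) / n ≤ SC (badCost l ε) B := by
  have hcard : (#{o ∈ B l | o ≠ none} : ℝ) ≤ 1 := by
    exact_mod_cast hE.card_ne_none_le_one hε hn hB
  have hsum : ∑ i, (#{o ∈ B i | o ≠ none} : ℝ) = n := by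
    exact_mod_cast hB.sum_card_ne_none.trans (Fintype.card_fin n)
  rw [← Finset.add_sum_erase _ _ (mem_univ l)] at hsum
  rw [SC, ← Finset.add_sum_erase _ _ (mem_univ l),
    Finset.sum_congr rfl fun i hi => sum_badCost_of_ne (ne_of_mem_erase hi) (B i),
    ← Finset.sum_mul, div_eq_mul_one_div]
  have hl : 0 ≤ ∑ o ∈ B l, badCost l ε l o :=
    Finset.sum_nonneg fun o _ => badCost_nonneg hε.le hn l o
  have := mul_le_mul_of_nonneg_right
    (show (n : ℝ) - 1 ≤ ∑ i ∈ univ.erase l, (#{o ∈ B i | o ≠ none} : ℝ) by linarith)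
    (show (0 : ℝ) ≤ 1 / n by positivity)
  linarith

end badCost

/-- For every `n ≥ 2` and `δ > 0` there is a normalized instance with some allocation of
social cost at most `δ` while every EQ1 allocation has social cost at least `(n-1)/n`;
hence the cost of EQ1 is at least `1 - 1/n`. -/
theorem cost_of_eq1_at_least (n : ℕ) (hn : 2 ≤ n) (δ : ℝ) (hδ : 0 < δ) :
    ∃ (ι : Type) (_ : Fintype ι) (_ : DecidableEq ι) (c : Fin n → ι → ℝ),
      (∀ i o, 0 ≤ c i o) ∧ (∀ i, ∑ o, c i o = 1) ∧
      (∃ A : Fin n → Finset ι, IsAllocation A ∧ SC c A ≤ δ) ∧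
      (∀ B : Fin n → Finset ι, IsAllocation B → EQ1 c B →
        ((n : ℝ) - 1) / n ≤ SC c B) := by
  have hn0 : (0 : ℝ) < n := by exact_mod_cast (by omega : 0 < n)
  have hε : 0 < min δ 1 / n := by positivity
  have hmul : n * (min δ 1 / n) = min δ 1 := mul_div_cancel₀ _ hn0.ne'
  have hle : n * (min δ 1 / n) ≤ 1 := hmul.trans_le (min_le_right _ _)
  have hne : (⟨1, hn⟩ : Fin n) ≠ ⟨0, by omega⟩ := by simp
  obtain ⟨A, hA, hSC⟩ := exists_isAllocation_SC_badCost (ε := min δ 1 / n) hne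
  exact ⟨Option (Fin n), inferInstance, inferInstance, badCost ⟨0, by omega⟩ (min δ 1 / n),
    badCost_nonneg hε.le hle, sum_badCost,
    ⟨A, hA, (hSC.trans hmul).trans_le (min_le_left _ _)⟩,
    fun B hB hE => hE.le_SC_badCost hε hle hB⟩
end

section
/- Fix an integer n ≥ 2 and a real ε with 0 < ε ≤ 1/n². Consider the normalized instance with agents {1,…,n} and items {o_1,…,o_{n+1}} whose costs are: c_1(o_j) = ε for 1 ≤ j ≤ n and c_1(o_{n+1}) = 1 − nε; and for every agent i ≥ 2, c_i(o_j) = 1/n for 1 ≤ j ≤ n and c_i(o_{n+1}) = 0. Then: (a) the allocation giving all of o_1,…,o_n to agent 1 and o_{n+1} to agent 2 has social cost nε; and (b) every EQ1 allocation of this instance has social cost at least (n−1)/n. -/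
open Finset

/-- The cost function of the hard instance:  agent `1` (index `0`) has cost `ε` on each of the
first `n` items and `1 - nε` on the last one; every other agent has cost `1/n` on each of the
first `n` items and `0` on the last one. -/
noncomputable def cEQ (n : ℕ) (ε : ℝ) (i : Fin n) (j : Fin (n + 1)) : ℝ :=
  if (j : ℕ) < n then (if (i : ℕ) = 0 then ε else 1 / n)
  else (if (i : ℕ) = 0 then 1 - n * ε else 0)

/-- The allocation giving the first `n` items to agent `1` (index `0`) and the last item to
agent `2` (index `1`). -/
def allocEQ (n : ℕ) : Fin n → Finset (Fin (n + 1)) := fun i =>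
  if (i : ℕ) = 0 then Finset.univ.filter (fun j : Fin (n + 1) => (j : ℕ) < n)
  else if (i : ℕ) = 1 then {Fin.last n} else ∅

/-- The number of items in `S` other than the last one. -/
def smallCount {n : ℕ} (S : Finset (Fin (n + 1))) : ℕ :=
  (S.filter fun j : Fin (n + 1) => (j : ℕ) < n).card

lemma smallCount_univ (n : ℕ) : smallCount (univ : Finset (Fin (n + 1))) = n := by
  have h : (univ.filter fun j : Fin (n + 1) => (j : ℕ) < n) = univ.erase (Fin.last n) := by
    ext j
    simp [← Fin.val_ne_iff]
    lia
  simp [smallCount, h]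

lemma sum_smallCount {n : ℕ} {B : Fin n → Finset (Fin (n + 1))} (hB : IsAllocation B) :
    ∑ i, smallCount (B i) = n := by
  have hU : univ.biUnion B = univ := by
    ext o
    simpa using hB.2 o
  conv_rhs => rw [← smallCount_univ n, ← hU]
  unfold smallCount
  rw [filter_biUnion, card_biUnion]
  exact fun i _ j _ hij => disjoint_filter_filter (hB.1 i j hij)

lemma sum_cEQ {n : ℕ} (ε : ℝ) (i : Fin n) (S : Finset (Fin (n + 1))) :
    ∑ o ∈ S, cEQ n ε i o = smallCount S * (if (i : ℕ) = 0 then ε else 1 / n) +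
      if Fin.last n ∈ S then (if (i : ℕ) = 0 then 1 - n * ε else 0) else 0 := by
  have hlast : (S.filter fun j : Fin (n + 1) => ¬ (j : ℕ) < n) =
      S.filter fun j => j = Fin.last n := by
    ext j
    simp only [mem_filter, Fin.ext_iff, Fin.val_last]
    lia
  unfold cEQ smallCount
  rw [sum_ite, sum_const, sum_const, nsmul_eq_mul, nsmul_eq_mul, hlast, filter_eq']
  split_ifs <;> simp

lemma sum_cEQ_of_ne_zero {n : ℕ} (ε : ℝ) {i : Fin n} (hi : (i : ℕ) ≠ 0)
    (S : Finset (Fin (n + 1))) : ∑ o ∈ S, cEQ n ε i o = smallCount S / n := by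
  rw [sum_cEQ]
  simp [hi, div_eq_mul_inv]

lemma isAllocation_allocEQ {n : ℕ} (hn : 2 ≤ n) : IsAllocation (allocEQ n) := by
  constructor
  · intro i j hij
    rw [Finset.disjoint_left]
    intro o hi hj
    apply hij
    simp only [allocEQ] at hi hj
    ext
    split_ifs at hi hj <;> simp_all
  · intro o
    by_cases ho : (o : ℕ) < n
    · exact ⟨⟨0, by lia⟩, by simp [allocEQ, ho]⟩
    · refine ⟨⟨1, by lia⟩, ?_⟩
      simp only [allocEQ, one_ne_zero, if_false, if_true, mem_singleton, Fin.ext_iff,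
        Fin.val_last]
      lia

/-- The social cost in terms of the bundle `B z` of the first agent `z`. -/
lemma SC_cEQ {n : ℕ} (ε : ℝ) {B : Fin n → Finset (Fin (n + 1))} (hB : IsAllocation B)
    {z : Fin n} (hz : (z : ℕ) = 0) :
    SC (cEQ n ε) B = smallCount (B z) * ε +
      (if Fin.last n ∈ B z then 1 - n * ε else 0) + (n - smallCount (B z)) / n := by
  have hrest : (∑ i ∈ univ.erase z, (smallCount (B i) : ℝ)) = n - smallCount (B z) := by
    have h := congrArg (Nat.cast (R := ℝ)) (sum_smallCount hB)
    rw [← add_sum_erase univ _ (mem_univ z)] at h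
    push_cast at h
    linarith
  rw [SC, ← add_sum_erase univ _ (mem_univ z), sum_cEQ, if_pos hz, if_pos hz, ← hrest, sum_div]
  congr 1
  refine sum_congr rfl fun i hi => sum_cEQ_of_ne_zero ε (fun h => ?_) _
  exact (mem_erase.mp hi).1 (Fin.ext (h.trans hz.symm))

/-- Under `EQ1`, if the first agent holds two small items then every other agent holds one. -/
lemma smallCount_pos_of_EQ1 {n : ℕ} {ε : ℝ} (hε : 0 < ε) (hnε : n * ε ≤ 1)
    {B : Fin n → Finset (Fin (n + 1))} (hE : EQ1 (cEQ n ε) B) {z i : Fin n}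
    (hz : (z : ℕ) = 0) (hi : (i : ℕ) ≠ 0) (hk : 2 ≤ smallCount (B z)) :
    1 ≤ smallCount (B i) := by
  obtain ⟨S, -, hS, hle⟩ := hE z i
  obtain ⟨o, ho, hoS⟩ := exists_mem_notMem_of_card_lt_card (lt_of_le_of_lt hS hk)
  rw [mem_filter] at ho
  have hpos : 1 ≤ smallCount (B z \ S) :=
    card_pos.mpr ⟨o, mem_filter.mpr ⟨mem_sdiff.mpr ⟨ho.1, hoS⟩, ho.2⟩⟩
  rw [sum_cEQ, if_pos hz, if_pos hz, sum_cEQ_of_ne_zero ε hi] at hle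
  by_contra! h0
  rw [Nat.lt_one_iff.mp h0, Nat.cast_zero, zero_div] at hle
  have h1 : 0 < (smallCount (B z \ S) : ℝ) * ε := mul_pos (by exact_mod_cast hpos) hε
  split_ifs at hle <;> linarith

theorem eq1_lower_bound_instance (n : ℕ) (hn : 2 ≤ n) (ε : ℝ) (hε : 0 < ε)
    (hε' : ε ≤ 1 / (n : ℝ) ^ 2) :
    (∀ i, ∑ o, cEQ n ε i o = 1) ∧
    IsAllocation (allocEQ n) ∧
    SC (cEQ n ε) (allocEQ n) = n * ε ∧
    (∀ B : Fin n → Finset (Fin (n + 1)), IsAllocation B → EQ1 (cEQ n ε) B →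
      ((n : ℝ) - 1) / n ≤ SC (cEQ n ε) B) := by
  have hn0 : (0 : ℝ) < n := by exact_mod_cast (by lia : 0 < n)
  have hn1 : (1 : ℝ) ≤ n := by exact_mod_cast (by lia : 1 ≤ n)
  have hεn : ε ≤ 1 / n := hε'.trans (one_div_le_one_div_of_le hn0 (by nlinarith))
  have hnε : n * ε ≤ 1 := by rwa [le_div_iff₀' hn0] at hεn
  refine ⟨fun i => ?_, isAllocation_allocEQ hn, ?_, fun B hB hE => ?_⟩
  · rw [sum_cEQ, smallCount_univ]
    by_cases hi : (i : ℕ) = 0 <;> simp [hi, hn0.ne']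
  · have hA : smallCount (allocEQ n ⟨0, by lia⟩) = n := by
      simpa [smallCount, allocEQ, filter_filter] using smallCount_univ n
    rw [SC_cEQ ε (isAllocation_allocEQ hn) (z := ⟨0, by lia⟩) rfl, hA]
    simp [allocEQ]
  · obtain ⟨z, hz⟩ : ∃ z : Fin n, (z : ℕ) = 0 := ⟨⟨0, by lia⟩, rfl⟩
    have hkn : smallCount (B z) ≤ n :=
      (single_le_sum (fun _ _ => Nat.zero_le _) (mem_univ z)).trans (sum_smallCount hB).le
    have hknR : (smallCount (B z) : ℝ) ≤ n := by exact_mod_cast hkn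
    have hkε : 0 ≤ (smallCount (B z) : ℝ) * ε := by positivity
    rw [SC_cEQ ε hB hz]
    split_ifs with hlast
    · have h1 : ((n : ℝ) - 1) / n ≤ 1 := by rw [div_le_one hn0]; linarith
      have h2 : ((n : ℝ) - smallCount (B z)) * ε ≤ (n - smallCount (B z)) / n := by
        rw [div_eq_mul_one_div]
        exact mul_le_mul_of_nonneg_left hεn (by linarith)
      linarith
    · have hk : smallCount (B z) ≤ 1 := by
        by_contra! hk
        have hcard : (univ.erase z).card • 1 ≤ ∑ i ∈ univ.erase z, smallCount (B i) :=
          card_nsmul_le_sum _ _ _ fun i hi =>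
            smallCount_pos_of_EQ1 hε hnε hE hz
              (fun h => (mem_erase.mp hi).1 (Fin.ext (h.trans hz.symm))) hk
        have hsum := sum_smallCount hB
        rw [← add_sum_erase univ _ (mem_univ z)] at hsum
        simp only [card_erase_of_mem (mem_univ z), card_univ, Fintype.card_fin, smul_eq_mul,
          mul_one] at hcard
        lia
      have hkR : (smallCount (B z) : ℝ) ≤ 1 := by exact_mod_cast hk
      have h1 : ((n : ℝ) - 1) / n ≤ (n - smallCount (B z)) / n := by gcongr
      linarith
end

section
/- For every normalized instance of indivisible chore allocation with n agents, there exists an EF1 allocation whose social cost is at most 1. In particular, since the minimum social cost over all allocations is nonnegative, the minimum social cost of an EF1 allocation exceeds the minimum social cost of an arbitrary allocation by at most 1 (the cost of EF1 is at most 1). -/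
open Finset

/-- Envy-freeness up to one item (for chores). -/
def EF1 {n : ℕ} {ι : Type*} [DecidableEq ι] (c : Fin n → ι → ℝ)
    (A : Fin n → Finset ι) : Prop :=
  ∀ i j : Fin n, ∃ S ⊆ A i, S.card ≤ 1 ∧ ∑ o ∈ A i \ S, c i o ≤ ∑ o ∈ A j, c i o

/-- Pickers act in turn, the `q`-th one having costs `g q` and taking a cheapest remaining item;
`e q` is the item picked at time `q`. -/
theorem exists_greedy_enumeration {ι : Type*} [DecidableEq ι] [Nonempty ι] (m : ℕ) :
    ∀ (s : Finset ι) (g : ℕ → ι → ℝ), s.card = m →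
      ∃ e : ℕ → ι, Set.InjOn e (range m) ∧ (range m).image e = s ∧
        ∀ p q, p ≤ q → q < m → g p (e p) ≤ g p (e q) := by
  induction m with
  | zero =>
    intro s g hs
    exact ⟨fun _ => Classical.arbitrary ι, by simp, by simp [card_eq_zero.mp hs], by simp⟩
  | succ m ih =>
    intro s g hs
    obtain ⟨a, ha, hmin⟩ := s.exists_min_image (g 0) (card_pos.mp (by omega))
    obtain ⟨e, hinj, himg, hle⟩ :=
      ih (s.erase a) (fun k => g (k + 1)) (by rw [card_erase_of_mem ha]; omega)
    have hmem : ∀ q < m, e q ∈ s.erase a := fun q hq =>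
      himg ▸ mem_image_of_mem e (mem_range.mpr hq)
    refine ⟨fun k => Nat.casesOn k a e, ?_, ?_, ?_⟩
    · rintro (_ | p) hp (_ | q) hq h
      · rfl
      · have := hmem q (by simpa using hq)
        simp_all
      · have := hmem p (by simpa using hp)
        simp_all
      · exact congrArg _ (hinj (by simpa using hp) (by simpa using hq) h)
    · rw [range_add_one', image_insert, map_eq_image, image_image, ← insert_erase ha, ← himg]
      rfl
    · rintro (_ | p) (_ | q) hpq hq
      · exact le_rfl
      · exact hmin _ (mem_of_mem_erase (hmem q (by omega)))
      · omega
      · exact hle p q (by omega) (by omega)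

theorem sum_eq_sum_range_of_enumeration {ι : Type*} [Fintype ι] [DecidableEq ι] {m : ℕ}
    {e : ℕ → ι} (hinj : Set.InjOn e (range m)) (himg : (range m).image e = univ) (F : ι → ℝ) :
    ∑ o, F o = ∑ q ∈ range m, F (e q) := by
  rw [← himg, sum_image hinj]

/-- An item that is cheapest among those left at time `q` costs at most as much as the `q`-th
item in increasing order of cost. -/
theorem cost_le_cost_sorted {ι : Type*} [DecidableEq ι] {m q : ℕ} {s : Finset ι} {v : ι → ℝ}
    {e t : ℕ → ι} (heimg : (range m).image e = s)
    (htinj : Set.InjOn t (range m)) (htimg : (range m).image t = s)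
    (hsorted : ∀ p r, p ≤ r → r < m → v (t p) ≤ v (t r)) (hq : q < m)
    (hcheap : ∀ r, q ≤ r → r < m → v (e q) ≤ v (e r)) : v (e q) ≤ v (t q) := by
  have hcard : ((range q).image e).card < ((range (q + 1)).image t).card := by
    rw [card_image_of_injOn (htinj.mono (coe_subset.mpr (range_subset_range.mpr hq)))]
    exact card_image_le.trans_lt (by simp)
  obtain ⟨o, hot, hoe⟩ := exists_mem_notMem_of_card_lt_card hcard
  obtain ⟨p, hp, rfl⟩ := mem_image.mp hot
  rw [mem_range] at hp
  have hs : t p ∈ (range m).image e :=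
    heimg ▸ htimg ▸ mem_image_of_mem t (mem_range.mpr (by omega))
  obtain ⟨r, hr, hrp⟩ := mem_image.mp hs
  have hqr : q ≤ r := by
    by_contra! h
    exact hoe (mem_image.mpr ⟨r, mem_range.mpr h, hrp⟩)
  calc v (e q) ≤ v (e r) := hcheap r hqr (mem_range.mp hr)
    _ = v (t p) := by rw [hrp]
    _ ≤ v (t q) := hsorted p q (by omega) hq

/-- The bundles when the item `e q` goes to agent `f q`, for each time `q < m`. -/
def pickingAllocation {n : ℕ} {ι : Type*} [DecidableEq ι] (m : ℕ) (f : ℕ → Fin n) (e : ℕ → ι)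
    (i : Fin n) : Finset ι :=
  ((range m).filter fun q => f q = i).image e

section pickingAllocation

variable {n m : ℕ} {ι : Type*} [DecidableEq ι] {f : ℕ → Fin n} {e : ℕ → ι}

theorem isAllocation_pickingAllocation [Fintype ι] (hinj : Set.InjOn e (range m))
    (himg : (range m).image e = univ) : IsAllocation (pickingAllocation m f e) := by
  constructor
  · intro i j hij
    rw [disjoint_left]
    intro o hi hj
    obtain ⟨p, hp, rfl⟩ := mem_image.mp hi
    obtain ⟨q, hq, hqp⟩ := mem_image.mp hj
    rw [mem_filter] at hp hq
    obtain rfl := hinj hq.1 hp.1 hqp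
    exact hij (hp.2.symm.trans hq.2)
  · intro o
    obtain ⟨q, hq, rfl⟩ := mem_image.mp (himg ▸ mem_univ o)
    exact ⟨f q, mem_image_of_mem e (mem_filter.mpr ⟨hq, rfl⟩)⟩

theorem SC_pickingAllocation (hinj : Set.InjOn e (range m)) (c : Fin n → ι → ℝ) :
    SC c (pickingAllocation m f e) = ∑ q ∈ range m, c (f q) (e q) := by
  rw [SC, ← sum_fiberwise (range m) f]
  refine sum_congr rfl fun i _ => ?_
  rw [pickingAllocation, sum_image (hinj.mono (by simp +contextual [Set.subset_def]))]
  exact sum_congr rfl fun q hq => by rw [(mem_filter.mp hq).2]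

/-- Greedy picking in cyclic order is envy-free up to the last item picked. -/
theorem EF1_pickingAllocation [NeZero n] {c : Fin n → ι → ℝ} (hnonneg : ∀ i o, 0 ≤ c i o)
    {s : Fin n} (hf : ∀ q : ℕ, f q = Fin.ofNat n q + s) (hinj : Set.InjOn e (range m))
    (hgreedy : ∀ p q, p ≤ q → q < m → c (f p) (e p) ≤ c (f p) (e q)) :
    EF1 c (pickingAllocation m f e) := by
  intro i j
  have hsub : ∀ k, ((range m).filter fun q => f q = k) ⊆ range m := fun k => filter_subset _ _
  set P := (range m).filter fun q => f q = i with hP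
  rcases P.eq_empty_or_nonempty with hempty | hne
  · refine ⟨∅, empty_subset _, by simp, ?_⟩
    simp only [pickingAllocation, ← hP, hempty, image_empty, empty_sdiff, sum_empty]
    exact sum_nonneg fun o _ => hnonneg i o
  set M := P.max' hne with hM
  have hMP : M ∈ P := P.max'_mem hne
  refine ⟨{e M}, singleton_subset_iff.mpr (mem_image_of_mem e hMP), by simp, ?_⟩
  set d := (j - i).val
  have hgap : ∀ q ∈ P.erase M, q + d < m := by
    intro q hq
    obtain ⟨hqM, hqP⟩ := mem_erase.mp hq
    have hlt : q < M := lt_of_le_of_ne (P.le_max' q hqP) hqM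
    have hqi := (mem_filter.mp hqP).2
    have hMi := (mem_filter.mp hMP).2
    have hMm := mem_range.mp (mem_filter.mp hMP).1
    rw [hf] at hqi hMi
    have hcast : Fin.ofNat n q = Fin.ofNat n M := add_right_cancel (hqi.trans hMi.symm)
    have hmod : q ≡ M [MOD n] := by simpa [Fin.ext_iff, Nat.ModEq] using hcast
    have := Nat.le_of_dvd (by omega) ((Nat.modEq_iff_dvd' hlt.le).mp hmod)
    have := (j - i).isLt
    omega
  have hremove : pickingAllocation m f e i \ {e M} ⊆ (P.erase M).image e := by
    intro o ho
    obtain ⟨hoi, hoM⟩ := mem_sdiff.mp ho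
    obtain ⟨q, hq, rfl⟩ := mem_image.mp hoi
    exact mem_image_of_mem e (mem_erase.mpr ⟨fun h => hoM (by simp [h]), hq⟩)
  have hshift : (P.erase M).image (· + d) ⊆ (range m).filter fun q => f q = j := by
    intro r hr
    obtain ⟨q, hq, rfl⟩ := mem_image.mp hr
    have hqi := (mem_filter.mp (mem_of_mem_erase hq)).2
    refine mem_filter.mpr ⟨mem_range.mpr (hgap q hq), ?_⟩
    rw [hf] at hqi ⊢
    rw [← Fin.ofNat_add, ← add_sub_cancel i j, ← hqi]
    abel
  calc ∑ o ∈ pickingAllocation m f e i \ {e M}, c i o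
      ≤ ∑ o ∈ (P.erase M).image e, c i o :=
        sum_le_sum_of_subset_of_nonneg hremove fun o _ _ => hnonneg i o
    _ = ∑ q ∈ P.erase M, c i (e q) :=
        sum_image (hinj.mono (coe_subset.mpr ((erase_subset _ _).trans (hsub i))))
    _ ≤ ∑ q ∈ P.erase M, c i (e (q + d)) := by
        refine sum_le_sum fun q hq => ?_
        have h := hgreedy q (q + d) (by omega) (hgap q hq)
        rwa [(mem_filter.mp (mem_of_mem_erase hq)).2] at h
    _ = ∑ r ∈ (P.erase M).image (· + d), c i (e r) :=
        (sum_image (f := fun r => c i (e r)) (add_left_injective d).injOn).symm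
    _ ≤ ∑ r ∈ (range m).filter fun q => f q = j, c i (e r) :=
        sum_le_sum_of_subset_of_nonneg hshift fun _ _ _ => hnonneg i _
    _ = ∑ o ∈ pickingAllocation m f e j, c i o :=
        (sum_image (hinj.mono (coe_subset.mpr (hsub j)))).symm

end pickingAllocation

/-- For every normalized chore instance there is an EF1 allocation of social cost at most 1;
in particular its social cost exceeds that of any allocation by at most 1. -/
theorem ef1_social_cost_at_most_one (n : ℕ) (hn : 1 ≤ n) (ι : Type*) [Fintype ι]
    [DecidableEq ι] (c : Fin n → ι → ℝ) (hnonneg : ∀ i o, 0 ≤ c i o)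
    (hnorm : ∀ i, ∑ o, c i o = 1) :
    ∃ A : Fin n → Finset ι, IsAllocation A ∧ EF1 c A ∧ SC c A ≤ 1 ∧
      ∀ B : Fin n → Finset ι, IsAllocation B → SC c A ≤ SC c B + 1 := by
  have : NeZero n := ⟨by omega⟩
  have : Nonempty ι := by
    by_contra h
    rw [not_nonempty_iff] at h
    simpa using hnorm 0
  set m := Fintype.card ι
  choose t htinj htimg hsorted using fun i : Fin n =>
    exists_greedy_enumeration m univ (fun _ => c i) rfl
  choose e hinj himg hgreedy using fun s : Fin n =>
    exists_greedy_enumeration m univ (fun q => c (Fin.ofNat n q + s)) rfl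
  let A : Fin n → Fin n → Finset ι := fun s =>
    pickingAllocation m (fun q => Fin.ofNat n q + s) (e s)
  have hbound : ∀ s, SC c (A s) ≤ ∑ q ∈ range m, c (Fin.ofNat n q + s) (t (Fin.ofNat n q + s) q) := by
    intro s
    rw [SC_pickingAllocation (hinj s)]
    refine sum_le_sum fun q hq => ?_
    exact cost_le_cost_sorted (himg s) (htinj _) (htimg _) (hsorted _) (mem_range.mp hq)
      (hgreedy s q)
  have htotal : ∑ s, SC c (A s) ≤ ∑ _s : Fin n, (1 : ℝ) := by
    refine (sum_le_sum fun s _ => hbound s).trans_eq ?_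
    rw [sum_comm]
    calc ∑ q ∈ range m, ∑ s, c (Fin.ofNat n q + s) (t (Fin.ofNat n q + s) q)
        = ∑ q ∈ range m, ∑ i, c i (t i q) :=
          sum_congr rfl fun q _ =>
            Equiv.sum_comp (Equiv.addLeft (Fin.ofNat n q)) fun i => c i (t i q)
      _ = ∑ i, ∑ q ∈ range m, c i (t i q) := sum_comm
      _ = ∑ _i : Fin n, (1 : ℝ) := sum_congr rfl fun i _ => by
          rw [← sum_eq_sum_range_of_enumeration (htinj i) (htimg i), hnorm]
  obtain ⟨s, -, hs⟩ := exists_le_of_sum_le univ_nonempty htotal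
  refine ⟨A s, isAllocation_pickingAllocation (hinj s) (himg s),
    EF1_pickingAllocation hnonneg (fun _ => rfl) (hinj s) (hgreedy s), hs, fun B _ => ?_⟩
  have : 0 ≤ SC c B := sum_nonneg fun i _ => sum_nonneg fun o _ => hnonneg i o
  linarith
end

section
/- For every integer n ≥ 2 and every real δ > 0, there exists a normalized instance of indivisible chore allocation with n agents in which some allocation has social cost at most δ, while every EQX allocation has social cost at least n − δ. Consequently, the cost of EQX — the supremum over instances of the minimum social cost of an EQX allocation minus the minimum social cost of an arbitrary allocation — is at least n. -/
open Finset

/-- Equitability up to any item. -/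
def EQX {n : ℕ} {ι : Type*} [DecidableEq ι] (c : Fin n → ι → ℝ)
    (A : Fin n → Finset ι) : Prop :=
  ∀ i j : Fin n, ∀ o ∈ A i, ∑ o' ∈ (A i).erase o, c i o' ≤ ∑ o' ∈ A j, c j o'

/-- The instance with one large item per agent, costly only to that agent, and `k` small items
of cost `ε` to everyone. -/
def scaleCost (n k : ℕ) (ε : ℝ) (i : Fin n) : Fin n ⊕ Fin k → ℝ
  | .inl j => if j = i then 1 - k * ε else 0
  | .inr _ => ε

theorem sum_scaleCost_filter {n k : ℕ} (ε : ℝ) (i : Fin n) (p : Fin n ⊕ Fin k → Prop)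
    [DecidablePred p] :
    ∑ o with p o, scaleCost n k ε i o =
      (if p (.inl i) then 1 - k * ε else 0) + ε * #{t | p (.inr t)} := by
  rw [Finset.sum_filter, Fintype.sum_sum_type]
  congr 1
  · rw [Finset.sum_eq_single i]
    · simp [scaleCost]
    · intro j _ hj
      simp [scaleCost, hj]
    · simp
  · rw [← Finset.sum_filter]
    simp [scaleCost, mul_comm]

theorem IsAllocation.exists_owner {n : ℕ} {ι : Type*} [Fintype ι] {B : Fin n → Finset ι}
    (hB : IsAllocation B) : ∃ f : ι → Fin n, ∀ i, B i = ({o | f o = i} : Finset ι) := by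
  choose f hf using hB.2
  refine ⟨f, fun i => ?_⟩
  ext o
  simp only [mem_filter, mem_univ, true_and]
  constructor
  · intro ho
    by_contra h
    exact Finset.disjoint_left.mp (hB.1 _ _ h) (hf o) ho
  · rintro rfl
    exact hf o

theorem isAllocation_filter {n : ℕ} {ι : Type*} [Fintype ι] (f : ι → Fin n) :
    IsAllocation fun i => ({o | f o = i} : Finset ι) := by
  refine ⟨fun i j hij => ?_, fun o => ⟨f o, by simp⟩⟩
  rw [Finset.disjoint_left]
  intro o hi hj
  simp only [mem_filter, mem_univ, true_and] at hi hj
  exact hij (hi.symm.trans hj)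

/-- If all values of `m` on `Q` lie within one of its minimum, and the sum of `m` over `Q` is `-1`
modulo the size of `Q`, then the minimum is attained only once. -/
theorem eq_of_min_of_card_dvd_sum_succ {α : Type*} [DecidableEq α] {Q : Finset α} {m : α → ℕ}
    {a b : α} (ha : a ∈ Q) (hb : b ∈ Q) (hmin : ∀ i ∈ Q, m a ≤ m i)
    (hmax : ∀ i ∈ Q, m i ≤ m a + 1) (hmb : m b = m a) (hdvd : #Q ∣ ∑ i ∈ Q, m i + 1) :
    b = a := by
  by_contra hba
  have hsum : ∑ i ∈ Q, m i = #Q * m a + #{i ∈ Q | m i = m a + 1} := by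
    rw [Finset.card_filter, ← smul_eq_mul, ← Finset.sum_const, ← Finset.sum_add_distrib]
    refine Finset.sum_congr rfl fun i hi => ?_
    have h1 := hmin i hi
    have h2 := hmax i hi
    split_ifs <;> omega
  have hsub : ({i ∈ Q | m i = m a + 1} : Finset α) ⊆ (Q.erase a).erase b := by
    intro i hi
    rw [mem_filter] at hi
    refine mem_erase.2 ⟨?_, mem_erase.2 ⟨?_, hi.1⟩⟩ <;> rintro rfl <;> omega
  have hcard := Finset.card_le_card hsub
  have hb' : b ∈ Q.erase a := mem_erase.2 ⟨hba, hb⟩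
  have hpos : 0 < #(Q.erase a) := Finset.card_pos.2 ⟨b, hb'⟩
  rw [Finset.card_erase_of_mem hb'] at hcard
  rw [Finset.card_erase_of_mem ha] at hcard hpos
  rw [hsum, add_assoc, Nat.dvd_add_right (Nat.dvd_mul_right _ _)] at hdvd
  have := Nat.le_of_dvd (Nat.succ_pos _) hdvd
  omega

/-- In an EQX allocation of the instance `scaleCost`, every agent receives her own large item. -/
theorem owner_inl_eq_self_of_eqx {n k : ℕ} {ε : ℝ} (hε : 0 < ε) (hk : 2 * (k * ε) < 1)
    (hdvd : ∀ q, 0 < q → q ≤ n → q ∣ k + 1) (f : Fin n ⊕ Fin k → Fin n)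
    (h : EQX (scaleCost n k ε) fun i => {o | f o = i}) (i : Fin n) : f (.inl i) = i := by
  by_contra hi
  let m : Fin n → ℕ := fun i => #{t | f (.inr t) = i}
  have hcost (i : Fin n) : ∑ o with f o = i, scaleCost n k ε i o =
      (if f (.inl i) = i then 1 - k * ε else 0) + ε * m i :=
    sum_scaleCost_filter ε i (f · = i)
  have hmk (i : Fin n) : ε * m i ≤ k * ε := by
    have : m i ≤ k := (Finset.card_le_univ _).trans_eq (Fintype.card_fin k)
    rw [mul_comm]
    gcongr
  have key (o : Fin n ⊕ Fin k) (j : Fin n) :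
      (if f (.inl (f o)) = f o then 1 - k * ε else 0) + ε * m (f o) ≤
        (if f (.inl j) = j then 1 - k * ε else 0) + ε * m j + scaleCost n k ε (f o) o := by
    have ho : o ∈ ({o' | f o' = f o} : Finset _) := by simp
    have := h (f o) j o ho
    rw [Finset.sum_erase_eq_sub ho, hcost, hcost] at this
    linarith
  have hmpos (t : Fin k) : (1 : ℝ) ≤ m (f (.inr t)) := by
    exact_mod_cast Finset.card_pos.2 ⟨t, by simp⟩
  let Q : Finset (Fin n) := {j | f (.inl j) ≠ j}
  have hmQ {j : Fin n} : j ∈ Q ↔ f (.inl j) ≠ j := by simp [Q]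
  have hinr (t : Fin k) : f (.inr t) ∈ Q := by
    rw [hmQ]
    intro ht
    have h1 := key (.inr t) i
    rw [if_pos ht, if_neg hi] at h1
    have h2 := hmk i
    have h3 := mul_le_mul_of_nonneg_left (hmpos t) hε.le
    simp only [scaleCost] at h1
    linarith
  have hinl {j : Fin n} (hj : j ∈ Q) : f (.inl j) ∈ Q := by
    rw [hmQ] at hj ⊢
    intro ht
    have h1 := key (.inl j) i
    rw [if_pos ht, if_neg hi] at h1
    have h2 := hmk i
    have h3 : 0 ≤ ε * m (f (.inl j)) := by positivity
    simp only [scaleCost, if_neg (Ne.symm hj)] at h1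
    linarith
  obtain ⟨a, ha, hmin⟩ := Q.exists_min_image m ⟨i, hmQ.2 hi⟩
  have hmax : ∀ j ∈ Q, m j ≤ m a + 1 := by
    intro j hj
    rcases Nat.eq_zero_or_pos (m j) with h0 | h0
    · omega
    · obtain ⟨t, ht⟩ := Finset.card_pos.1 h0
      obtain rfl : f (.inr t) = j := by simpa using ht
      have h1 := key (.inr t) a
      rw [if_neg (hmQ.1 hj), if_neg (hmQ.1 ha)] at h1
      simp only [scaleCost] at h1
      have h2 : ε * m (f (.inr t)) ≤ ε * (m a + 1) := by linarith
      exact_mod_cast le_of_mul_le_mul_left h2 hε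
  have hb : m (f (.inl a)) = m a := by
    refine le_antisymm ?_ (hmin _ (hinl ha))
    have h1 := key (.inl a) a
    rw [if_neg (hmQ.1 (hinl ha)), if_neg (hmQ.1 ha)] at h1
    simp only [scaleCost, if_neg (Ne.symm (hmQ.1 ha))] at h1
    have h2 : ε * m (f (.inl a)) ≤ ε * m a := by linarith
    exact_mod_cast le_of_mul_le_mul_left h2 hε
  have hsum : ∑ j ∈ Q, m j = k := by
    rw [← Finset.card_eq_sum_card_fiberwise (s := univ) fun t _ => hinr t]
    simp
  refine hmQ.1 ha (eq_of_min_of_card_dvd_sum_succ ha (hinl ha) hmin hmax hb ?_)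
  rw [hsum]
  exact hdvd _ (Finset.card_pos.2 ⟨a, ha⟩) ((Finset.card_le_univ _).trans_eq (Fintype.card_fin n))

/-- For every `n ≥ 2` and `δ > 0` there is a normalized instance with some allocation of
social cost at most `δ` while every EQX allocation has social cost at least `n - δ`;
hence the cost of EQX is at least `n`. -/
theorem cost_of_eqx_at_least (n : ℕ) (hn : 2 ≤ n) (δ : ℝ) (hδ : 0 < δ) :
    ∃ (ι : Type) (_ : Fintype ι) (_ : DecidableEq ι) (c : Fin n → ι → ℝ),
      (∀ i o, 0 ≤ c i o) ∧ (∀ i, ∑ o, c i o = 1) ∧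
      (∃ A : Fin n → Finset ι, IsAllocation A ∧ SC c A ≤ δ) ∧
      (∀ B : Fin n → Finset ι, IsAllocation B → EQX c B →
        (n : ℝ) - δ ≤ SC c B) := by
  obtain ⟨k, hk⟩ : ∃ k, k + 1 = n.factorial := ⟨_, Nat.sub_add_cancel n.factorial_pos⟩
  obtain ⟨ε, hε, hεδ, hε1⟩ : ∃ ε : ℝ, 0 < ε ∧ n * (k * ε) ≤ δ ∧ n * (k * ε) < 1 := by
    have hn0 : (0 : ℝ) < n := by exact_mod_cast (by omega : 0 < n)
    refine ⟨min δ (1 / 2) / (n * (k + 1)), by positivity, ?_⟩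
    have hle : n * (k * (min δ (1 / 2) / (n * (k + 1)))) ≤ min δ (1 / 2) := by
      have : n * (k * (min δ (1 / 2) / (n * (k + 1)))) = min δ (1 / 2) * (k / (k + 1)) := by
        field_simp
      rw [this]
      refine mul_le_of_le_one_right (by positivity) ?_
      rw [div_le_one (by positivity)]
      linarith
    exact ⟨hle.trans (min_le_left _ _), by linarith [min_le_right δ (1 / 2)]⟩
  have hkε : 0 ≤ k * ε := by positivity
  have hn2 : (2 : ℝ) ≤ n := by exact_mod_cast hn
  have h2 : 2 * (k * ε) < 1 := (mul_le_mul_of_nonneg_right hn2 hkε).trans_lt hε1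
  refine ⟨Fin n ⊕ Fin k, inferInstance, inferInstance, scaleCost n k ε, ?_, ?_, ?_, ?_⟩
  · rintro i (j | t)
    · simp only [scaleCost]
      split_ifs <;> linarith
    · exact hε.le
  · intro i
    have := sum_scaleCost_filter (k := k) ε i (fun _ => True)
    simp only [filter_true, if_true, card_univ, Fintype.card_fin] at this
    linarith
  · obtain ⟨n, rfl⟩ := Nat.exists_eq_add_of_le' hn
    let f : Fin (n + 2) ⊕ Fin k → Fin (n + 2) := Sum.elim (· + 1) fun _ => 0
    refine ⟨_, isAllocation_filter f, ?_⟩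
    have hcost (i : Fin (n + 2)) : ∑ o with f o = i, scaleCost (n + 2) k ε i o ≤ k * ε := by
      rw [sum_scaleCost_filter, if_neg (by simp [f]), zero_add, mul_comm]
      gcongr
      exact (Finset.card_le_univ _).trans_eq (Fintype.card_fin k)
    refine (Finset.sum_le_sum fun i _ => hcost i).trans ?_
    simpa using hεδ
  · intro B hB hEQX
    obtain ⟨f, hf⟩ := hB.exists_owner
    obtain rfl : B = fun i => ({o | f o = i} : Finset _) := funext hf
    have hown := owner_inl_eq_self_of_eqx hε h2
      (fun q hq hqn => hk ▸ Nat.dvd_factorial hq hqn) f hEQX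
    have hcost (i : Fin n) : 1 - k * ε ≤ ∑ o with f o = i, scaleCost n k ε i o := by
      rw [sum_scaleCost_filter, if_pos (hown i)]
      have : 0 ≤ ε * #{t | f (.inr t) = i} := by positivity
      linarith
    refine le_trans ?_ (Finset.sum_le_sum fun i _ => hcost i)
    simp only [sum_const, card_univ, Fintype.card_fin, nsmul_eq_mul]
    linarith
end

section
/- Fix an integer n ≥ 2, positive integers p_1,…,p_r with Σ_j p_j = 2T, and a real K. Consider the instance with n agents and items O¹ = {o¹_1,…,o¹_n}, O² = {o²_1,…,o²_r}, O³ = {o³_1,…,o³_n}, with costs: for agents i ∈ {1,2}: c_i(o²_j) = p_j for all j, c_i(o³_i) = 4T, and c_i(o³_j) = 10·n^{i−1}·T for j ≠ i; for agents i ≥ 3: c_i(o²_j) = 10·r^{i−2}·n^{n+i−2}·T for all j, c_i(o³_i) = 5T, and c_i(o³_j) = 10·n^{i−1}·T for j ≠ i; and, writing x_i = c_i(O² ∪ O³), c_i(o¹_i) = K − x_i and c_i(o¹_j) = 0 for j ≠ i (so c_i(O) = K for every agent i). Suppose K ≥ max_i x_i and that there is a partition of {1,…,r} into I₁, I₂ with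 Σ_{j∈I₁} p_j = Σ_{j∈I₂} p_j = T. Then the allocation A₁ = {o¹_2,…,o¹_n} ∪ {o²_j : j ∈ I₁} ∪ {o³_1}, A₂ = {o¹_1} ∪ {o²_j : j ∈ I₂} ∪ {o³_2}, and A_i = {o³_i} for 3 ≤ i ≤ n satisfies c_i(A_i) = 5T for every agent i, is EQX, and has social cost 5nT, which equals the minimum social cost over all allocations of this instance. -/
open Finset

/-- Cost of agent `i` (0-indexed) on item `o²_{j+1}`:  `p j` for the first two agents, and
`10·r^{i-1}·n^{n+i-1}·T` for agents with index `≥ 2` (i.e. agents `3,…,n`, 1-indexed). -/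
noncomputable def cO2 (n r T : ℕ) (p : Fin r → ℕ) (i : Fin n) (j : Fin r) : ℝ :=
  if (i : ℕ) ≤ 1 then (p j : ℝ)
  else 10 * (r : ℝ) ^ ((i : ℕ) - 1) * (n : ℝ) ^ (n + (i : ℕ) - 1) * T

/-- Cost of agent `i` (0-indexed) on item `o³_{j+1}`: on the diagonal it is `4T` for the first
two agents and `5T` for the others; off the diagonal it is `10·n^i·T`. -/
noncomputable def cO3 (n T : ℕ) (i j : Fin n) : ℝ :=
  if j = i then (if (i : ℕ) ≤ 1 then 4 * (T : ℝ) else 5 * T)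
  else 10 * (n : ℝ) ^ (i : ℕ) * T

/-- `x_i = c_i(O² ∪ O³)`. -/
noncomputable def xEQX (n r T : ℕ) (p : Fin r → ℕ) (i : Fin n) : ℝ :=
  (∑ j : Fin r, cO2 n r T p i j) + ∑ j : Fin n, cO3 n T i j

/-- The full cost function: items are `O¹ ⊕ (O² ⊕ O³)`; agent `i` has cost `K - x_i` on her
own big item `o¹_i` and cost `0` on the other big items. -/
noncomputable def cEQX (n r T : ℕ) (p : Fin r → ℕ) (K : ℝ) (i : Fin n) :
    Fin n ⊕ (Fin r ⊕ Fin n) → ℝ := fun o =>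
  match o with
  | Sum.inl j => if j = i then K - xEQX n r T p i else 0
  | Sum.inr (Sum.inl j) => cO2 n r T p i j
  | Sum.inr (Sum.inr j) => cO3 n T i j

/-- The allocation of the "yes" case: agent `1` (index 0) gets `o¹_2,…,o¹_n`, the `O²`-items
indexed by `I`, and `o³_1`; agent `2` (index 1) gets `o¹_1`, the remaining `O²`-items and
`o³_2`; every other agent `i` gets `o³_i` only. -/
def allocEQX (n r : ℕ) (hn : 2 ≤ n) (I : Finset (Fin r)) :
    Fin n → Finset (Fin n ⊕ (Fin r ⊕ Fin n)) := fun i =>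
  if (i : ℕ) = 0 then
    ((Finset.univ.erase (⟨0, by omega⟩ : Fin n)).image Sum.inl) ∪
      (I.image fun j => Sum.inr (Sum.inl j)) ∪
      {Sum.inr (Sum.inr (⟨0, by omega⟩ : Fin n))}
  else if (i : ℕ) = 1 then
    {Sum.inl (⟨0, by omega⟩ : Fin n)} ∪ ((Iᶜ).image fun j => Sum.inr (Sum.inl j)) ∪
      {Sum.inr (Sum.inr (⟨1, by omega⟩ : Fin n))}
  else {Sum.inr (Sum.inr i)}

/-- The cheapest cost at which any agent can be assigned a given item. -/
noncomputable def minCost (n r T : ℕ) (p : Fin r → ℕ) : Fin n ⊕ (Fin r ⊕ Fin n) → ℝ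
  | Sum.inl _ => 0
  | Sum.inr (Sum.inl j) => p j
  | Sum.inr (Sum.inr j) => if (j : ℕ) ≤ 1 then 4 * (T : ℝ) else 5 * T

theorem minCost_nonneg (n r T : ℕ) (p : Fin r → ℕ) (o : Fin n ⊕ (Fin r ⊕ Fin n)) :
    0 ≤ minCost n r T p o := by
  rcases o with j | j | j
  · simp [minCost]
  · simp [minCost]
  · simp only [minCost]
    split_ifs <;> positivity

theorem minCost_le_cEQX (n r T : ℕ) (p : Fin r → ℕ) (hsum : ∑ j, p j = 2 * T) (K : ℝ)
    (hK : ∀ i : Fin n, xEQX n r T p i ≤ K) (i : Fin n) (o : Fin n ⊕ (Fin r ⊕ Fin n)) :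
    minCost n r T p o ≤ cEQX n r T p K i o := by
  have hT : (0 : ℝ) ≤ T := T.cast_nonneg
  have hn : (1 : ℝ) ≤ n := by exact_mod_cast i.pos
  rcases o with j | j | j
  · simp only [minCost, cEQX]
    split_ifs
    · exact sub_nonneg.2 (hK i)
    · exact le_rfl
  · simp only [minCost, cEQX, cO2]
    split_ifs
    · exact le_rfl
    · have hr : (1 : ℝ) ≤ r := by exact_mod_cast j.pos
      have hpj : (p j : ℝ) ≤ 2 * T := by
        exact_mod_cast hsum ▸ Finset.single_le_sum (fun k _ => Nat.zero_le (p k)) (mem_univ j)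
      have h := mul_le_mul_of_nonneg_right (one_le_mul_of_one_le_of_one_le
        (one_le_pow₀ hr (n := (i : ℕ) - 1)) (one_le_pow₀ hn (n := n + (i : ℕ) - 1))) hT
      linarith
  · simp only [minCost, cEQX, cO3]
    have h := mul_le_mul_of_nonneg_right (one_le_pow₀ hn (n := (i : ℕ))) hT
    by_cases hj : j = i
    · subst hj
      simp
    · rw [if_neg hj]
      split_ifs <;> linarith

theorem sum_minCost (n r T : ℕ) (hn : 2 ≤ n) (p : Fin r → ℕ) (hsum : ∑ j, p j = 2 * T) :
    ∑ o, minCost n r T p o = 5 * n * T := by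
  obtain ⟨k, rfl⟩ := Nat.exists_eq_add_of_le' hn
  have h : (∑ j, (p j : ℝ)) = 2 * T := by exact_mod_cast hsum
  simp only [Fintype.sum_sum_type, minCost, h, Fin.sum_univ_succ]
  simp
  ring

theorem IsAllocation.sum_sum_eq {n : ℕ} {ι : Type*} [Fintype ι] {B : Fin n → Finset ι}
    (hB : IsAllocation B) (f : ι → ℝ) : ∑ i, ∑ o ∈ B i, f o = ∑ o, f o := by
  classical
  rw [← Finset.sum_biUnion fun i _ j _ hij => hB.1 i j hij]
  congr 1
  ext o
  simpa using hB.2 o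

theorem IsAllocation.sum_minCost_le_SC (n r T : ℕ) (p : Fin r → ℕ) (hsum : ∑ j, p j = 2 * T)
    (K : ℝ) (hK : ∀ i : Fin n, xEQX n r T p i ≤ K)
    {B : Fin n → Finset (Fin n ⊕ (Fin r ⊕ Fin n))} (hB : IsAllocation B) :
    ∑ o, minCost n r T p o ≤ SC (cEQX n r T p K) B := by
  rw [← hB.sum_sum_eq]
  exact sum_le_sum fun i _ => sum_le_sum fun o _ => minCost_le_cEQX n r T p hsum K hK i o

theorem isAllocation_allocEQX (n r : ℕ) (hn : 2 ≤ n) (I : Finset (Fin r)) :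
    IsAllocation (allocEQX n r hn I) := by
  refine ⟨fun i j hij => ?_, fun o => ?_⟩
  · rw [Ne, Fin.ext_iff] at hij
    rw [Finset.disjoint_left]
    rintro (k | k | k) <;> simp only [allocEQX] <;> split_ifs
    all_goals first
      | omega
      | simp; done
      | simp [Fin.ext_iff]; omega
  · rcases o with k | k | k
    · by_cases hk : (k : ℕ) = 0
      · exact ⟨⟨1, by omega⟩, by simp [allocEQX, Fin.ext_iff, hk]⟩
      · exact ⟨⟨0, by omega⟩, by simpa [allocEQX] using fun h => hk (Fin.ext_iff.1 h)⟩
    · by_cases hk : k ∈ I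
      · exact ⟨⟨0, by omega⟩, by simp [allocEQX, hk]⟩
      · exact ⟨⟨1, by omega⟩, by simp [allocEQX, hk]⟩
    · refine ⟨k, ?_⟩
      simp only [allocEQX]
      split_ifs <;> simp [Fin.ext_iff, *]

theorem sum_allocEQX (n r T : ℕ) (hn : 2 ≤ n) (p : Fin r → ℕ) (K : ℝ) (I : Finset (Fin r))
    (hI1 : ∑ j ∈ I, p j = T) (hI2 : ∑ j ∈ Iᶜ, p j = T) (i : Fin n) :
    ∑ o ∈ allocEQX n r hn I i, cEQX n r T p K i o = 5 * T := by
  have h1 : ∑ j ∈ I, (p j : ℝ) = T := by exact_mod_cast hI1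
  have h2 : ∑ j ∈ Iᶜ, (p j : ℝ) = T := by exact_mod_cast hI2
  simp only [allocEQX]
  split_ifs with hi0 hi1
  · have hi : (⟨0, by omega⟩ : Fin n) = i := Fin.ext hi0.symm
    rw [hi]
    rw [sum_union (by simp [Finset.disjoint_left]), sum_union (by simp [Finset.disjoint_left]),
      sum_image (by simp), sum_image (by simp),
      sum_eq_zero (f := fun j => cEQX n r T p K i (Sum.inl j)) fun j hj => if_neg (ne_of_mem_erase hj)]
    simp only [cEQX, cO2, cO3, sum_singleton, hi0, zero_le, if_true, h1]
    ring
  · have hi : (⟨1, by omega⟩ : Fin n) = i := Fin.ext hi1.symm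
    rw [hi]
    rw [sum_union (by simp [Finset.disjoint_left]), sum_union (by simp),
      sum_image (by simp)]
    simp only [cEQX, cO2, cO3, sum_singleton, hi1, le_refl, if_true, h2]
    rw [if_neg (by simp [Fin.ext_iff, hi1])]
    ring
  · have hi : ¬ (i : ℕ) ≤ 1 := by omega
    simp [cEQX, cO3, hi]

theorem eqx_yes_instance (n r T : ℕ) (hn : 2 ≤ n) (p : Fin r → ℕ) (hp : ∀ j, 0 < p j)
    (hsum : ∑ j, p j = 2 * T) (K : ℝ) (hK : ∀ i : Fin n, xEQX n r T p i ≤ K)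
    (I : Finset (Fin r)) (hI1 : ∑ j ∈ I, p j = T) (hI2 : ∑ j ∈ Iᶜ, p j = T) :
    IsAllocation (allocEQX n r hn I) ∧
    (∀ i : Fin n, ∑ o ∈ allocEQX n r hn I i, cEQX n r T p K i o = 5 * T) ∧
    EQX (cEQX n r T p K) (allocEQX n r hn I) ∧
    SC (cEQX n r T p K) (allocEQX n r hn I) = 5 * n * T ∧
    (∀ B : Fin n → Finset (Fin n ⊕ (Fin r ⊕ Fin n)), IsAllocation B →
      SC (cEQX n r T p K) (allocEQX n r hn I) ≤ SC (cEQX n r T p K) B) := by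
  have halloc := isAllocation_allocEQX n r hn I
  have hcost := sum_allocEQX n r T hn p K I hI1 hI2
  have hSC : SC (cEQX n r T p K) (allocEQX n r hn I) = 5 * n * T := by
    simp only [SC, hcost, sum_const, card_univ, Fintype.card_fin, nsmul_eq_mul]
    ring
  refine ⟨halloc, hcost, fun i j o _ => ?_, hSC, fun B hB => ?_⟩
  · rw [hcost j, ← hcost i]
    exact sum_le_sum_of_subset_of_nonneg (erase_subset _ _) fun o' _ _ =>
      (minCost_nonneg n r T p o').trans (minCost_le_cEQX n r T p hsum K hK i o')
  · rw [hSC, ← sum_minCost n r T hn p hsum]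
    exact hB.sum_minCost_le_SC n r T p hsum K hK
end

section
/- Let p_1,…,p_r be positive integers with Σ_j p_j = 2T and let K be a real number with K ≥ 5T. Consider the instance with 2 agents and items o_1,…,o_{r+3}, where c_1(o_j) = p_j for 1 ≤ j ≤ r, c_1(o_{r+1}) = 6K, c_1(o_{r+2}) = 2K, c_1(o_{r+3}) = 0; and c_2(o_j) = p_j/2 for 1 ≤ j ≤ r, c_2(o_{r+1}) = 5K, c_2(o_{r+2}) = c_2(o_{r+3}) = (3K + T)/2 (so each agent's total cost is 8K + 2T). Then: (a) if {1,…,r} admits a partition into I₁, I₂ with Σ_{j∈I₁} p_j = Σ_{j∈I₂} p_j = T, then the allocation A₁ = {o_{r+3}} ∪ {o_j : j ∈ I₁}, A₂ = {o_{r+1}, o_{r+2}} ∪ {o_j : j ∈ I₂} is EF1 and has social cost 13K/2 + 2T; and (b) if no such partition exists, then every EF1 allocation of this instance has social cost strictly greater than 13K/2 + 2T. -/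
open Finset

/-- Items are `Fin r ⊕ Fin 3`, where `Sum.inr 0, Sum.inr 1, Sum.inr 2` are
`o_{r+1}, o_{r+2}, o_{r+3}`.  Agent `1` (index 0) has costs `p_j, 6K, 2K, 0`; agent `2`
(index 1) has costs `p_j/2, 5K, (3K+T)/2, (3K+T)/2`. -/
noncomputable def cTwo (r T : ℕ) (p : Fin r → ℕ) (K : ℝ) (i : Fin 2) :
    Fin r ⊕ Fin 3 → ℝ := fun o =>
  match o with
  | Sum.inl j => if i = 0 then (p j : ℝ) else (p j : ℝ) / 2
  | Sum.inr k =>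
      if i = 0 then (if k = 0 then 6 * K else if k = 1 then 2 * K else 0)
      else (if k = 0 then 5 * K else (3 * K + T) / 2)

/-- The allocation `A₁ = {o_{r+3}} ∪ {o_j : j ∈ I}`, `A₂ = {o_{r+1}, o_{r+2}} ∪ {o_j : j ∉ I}`. -/
def allocTwo (r : ℕ) (I : Finset (Fin r)) : Fin 2 → Finset (Fin r ⊕ Fin 3) := fun i =>
  if i = 0 then insert (Sum.inr 2) (I.image Sum.inl)
  else insert (Sum.inr 0) (insert (Sum.inr 1) ((Iᶜ).image Sum.inl))

/-- The cost of a bundle for agent `1`: its small items, plus its large items. -/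
lemma sum_cTwo_zero (r T : ℕ) (p : Fin r → ℕ) (K : ℝ) (S : Finset (Fin r ⊕ Fin 3)) :
    ∑ o ∈ S, cTwo r T p K 0 o = ((∑ j with Sum.inl j ∈ S, p j : ℕ) : ℝ) +
      ((if Sum.inr 0 ∈ S then 6 * K else 0) + (if Sum.inr 1 ∈ S then 2 * K else 0)) := by
  rw [← Finset.filter_univ_mem S, Finset.sum_filter, Fintype.sum_sum_type,
    Fin.sum_univ_three]
  simp [cTwo, Finset.sum_filter]

/-- The cost of a bundle for agent `2`: its small items, plus its large items. -/
lemma sum_cTwo_one (r T : ℕ) (p : Fin r → ℕ) (K : ℝ) (S : Finset (Fin r ⊕ Fin 3)) :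
    ∑ o ∈ S, cTwo r T p K 1 o = ((∑ j with Sum.inl j ∈ S, p j : ℕ) : ℝ) / 2 +
      ((if Sum.inr 0 ∈ S then 5 * K else 0) + (if Sum.inr 1 ∈ S then (3 * K + T) / 2 else 0) +
        (if Sum.inr 2 ∈ S then (3 * K + T) / 2 else 0)) := by
  rw [← Finset.filter_univ_mem S, Finset.sum_filter, Fintype.sum_sum_type,
    Fin.sum_univ_three]
  simp [cTwo, Finset.sum_filter, Finset.sum_div, ite_div]

/-- The item `o_{r+1}` is a most costly one for agent `2`. -/
lemma cTwo_one_le (r T : ℕ) (p : Fin r → ℕ) (hsum : ∑ j, p j = 2 * T) (K : ℝ)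
    (hK : 5 * (T : ℝ) ≤ K) (o : Fin r ⊕ Fin 3) : cTwo r T p K 1 o ≤ 5 * K := by
  have hT : (0 : ℝ) ≤ T := T.cast_nonneg
  rcases o with j | k
  · have h : p j ≤ 2 * T := hsum ▸ Finset.single_le_sum (fun _ _ => Nat.zero_le _) (mem_univ j)
    have h' : (p j : ℝ) ≤ 2 * T := by exact_mod_cast h
    simp only [cTwo, one_ne_zero, if_false]
    linarith
  · simp only [cTwo, one_ne_zero, if_false]
    split_ifs <;> linarith

lemma isAllocation_allocTwo (r : ℕ) (I : Finset (Fin r)) : IsAllocation (allocTwo r I) := by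
  have hd : Disjoint (allocTwo r I 0) (allocTwo r I 1) := by
    rw [Finset.disjoint_left]
    rintro (j | k) <;> simp [allocTwo]
    rintro rfl
    decide
  refine ⟨fun i j hij => ?_, ?_⟩
  · fin_cases i <;> fin_cases j
    · exact absurd rfl hij
    · exact hd
    · exact hd.symm
    · exact absurd rfl hij
  · rintro (j | k)
    · by_cases hj : j ∈ I
      · exact ⟨0, by simp [allocTwo, hj]⟩
      · exact ⟨1, by simp [allocTwo, hj]⟩
    · fin_cases k
      · exact ⟨1, by simp [allocTwo]⟩
      · exact ⟨1, by simp [allocTwo]⟩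
      · exact ⟨0, by simp [allocTwo]⟩

lemma IsAllocation.eq_compl {ι : Type*} [Fintype ι] [DecidableEq ι] {A : Fin 2 → Finset ι}
    (hA : IsAllocation A) : A 1 = (A 0)ᶜ := by
  ext o
  rw [Finset.mem_compl]
  refine ⟨fun h1 h0 => Finset.disjoint_left.1 (hA.1 0 1 (by decide)) h0 h1, fun h0 => ?_⟩
  obtain ⟨i, hi⟩ := hA.2 o
  fin_cases i
  · exact absurd hi h0
  · exact hi

theorem ef1_two_agents_hardness (r T : ℕ) (p : Fin r → ℕ) (hp : ∀ j, 0 < p j)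
    (hsum : ∑ j, p j = 2 * T) (K : ℝ) (hK : 5 * (T : ℝ) ≤ K) :
    ((∀ I : Finset (Fin r), ∑ j ∈ I, p j = T → ∑ j ∈ Iᶜ, p j = T →
        IsAllocation (allocTwo r I) ∧ EF1 (cTwo r T p K) (allocTwo r I) ∧
          SC (cTwo r T p K) (allocTwo r I) = 13 * K / 2 + 2 * T)) ∧
    ((¬ ∃ I : Finset (Fin r), ∑ j ∈ I, p j = T) →
      ∀ B : Fin 2 → Finset (Fin r ⊕ Fin 3), IsAllocation B → EF1 (cTwo r T p K) B →
        13 * K / 2 + 2 * (T : ℝ) < SC (cTwo r T p K) B) := by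
  have hT : (0 : ℝ) ≤ T := T.cast_nonneg
  refine ⟨fun I hI hIc => ⟨isAllocation_allocTwo r I, ?_, ?_⟩, fun hno B hB hEF => ?_⟩
  · have h00 : ∑ o ∈ allocTwo r I 0, cTwo r T p K 0 o = T := by
      rw [sum_cTwo_zero]
      simp [allocTwo, hI]
    have h01 : ∑ o ∈ allocTwo r I 1, cTwo r T p K 0 o = T + (6 * K + 2 * K) := by
      rw [sum_cTwo_zero]
      simp [allocTwo, ← Finset.compl_filter, hIc]
    have h10 : ∑ o ∈ allocTwo r I 0, cTwo r T p K 1 o = T / 2 + (3 * K + T) / 2 := by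
      rw [sum_cTwo_one]
      simp [allocTwo, hI]
    have h11 : ∑ o ∈ allocTwo r I 1 \ {Sum.inr 0}, cTwo r T p K 1 o = T / 2 + (3 * K + T) / 2 := by
      rw [sum_cTwo_one]
      simp [allocTwo, ← Finset.compl_filter, hIc]
    have h11' : ∑ o ∈ allocTwo r I 1, cTwo r T p K 1 o = T / 2 + (5 * K + (3 * K + T) / 2) := by
      rw [sum_cTwo_one]
      simp [allocTwo, ← Finset.compl_filter, hIc]
    rw [EF1, Fin.forall_fin_two, Fin.forall_fin_two, Fin.forall_fin_two]
    refine ⟨⟨⟨∅, by simp⟩, ∅, by simp, by simp, ?_⟩,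
      ⟨{Sum.inr 0}, by simp [allocTwo], by simp, (h11.trans h10.symm).le⟩,
      {Sum.inr 0}, by simp [allocTwo], by simp, ?_⟩
    · rw [Finset.sdiff_empty, h00, h01]
      linarith
    · rw [h11, h11']
      linarith
  · rw [SC, Fin.sum_univ_two, sum_cTwo_zero, sum_cTwo_one]
    simp [allocTwo, ← Finset.compl_filter, hI, hIc]
    ring
  · obtain ⟨S, hS, hcard, hle⟩ := hEF 1 0
    have hSle : ∑ o ∈ S, cTwo r T p K 1 o ≤ 5 * K := by
      refine (Finset.sum_le_card_nsmul S _ _ fun o _ => cTwo_one_le r T p hsum K hK o).trans ?_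
      have hc : (S.card : ℝ) ≤ 1 := by exact_mod_cast hcard
      rw [nsmul_eq_mul]
      nlinarith
    have hsplit := Finset.sum_sdiff (f := cTwo r T p K 1) hS
    have hX : ∑ j with Sum.inl j ∈ B 0, p j ≠ T := fun h => hno ⟨_, h⟩
    have hXY : ∑ j with Sum.inl j ∈ B 0, p j + ∑ j with Sum.inl j ∈ B 1, p j = 2 * T := by
      simp only [hB.eq_compl, Finset.mem_compl]
      rw [Finset.sum_filter_add_sum_filter_not, hsum]
    have hTpos : (0 : ℝ) < T := by
      refine lt_of_le_of_ne hT fun h => hno ⟨∅, ?_⟩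
      rw [Finset.sum_empty]
      exact_mod_cast h
    rw [SC, Fin.sum_univ_two, sum_cTwo_zero]
    rw [sum_cTwo_one r T p K (B 0)] at hle
    rw [sum_cTwo_one r T p K (B 1)] at hsplit ⊢
    generalize ∑ j with Sum.inl j ∈ B 0, p j = X at *
    generalize ∑ j with Sum.inl j ∈ B 1, p j = Y at *
    have hXY' : (X : ℝ) + Y = 2 * T := by exact_mod_cast hXY
    have hX0 : (0 : ℝ) ≤ X := X.cast_nonneg
    have hX' : (X : ℝ) ≠ T := by exact_mod_cast hX
    simp only [hB.eq_compl, Finset.mem_compl] at hle hsplit ⊢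
    by_cases h0 : Sum.inr 0 ∈ B 0 <;> by_cases h1 : Sum.inr 1 ∈ B 0 <;>
      by_cases h2 : Sum.inr 2 ∈ B 0 <;>
      simp only [h0, h1, h2, not_true_eq_false, not_false_eq_true, if_true, if_false] at hle hsplit ⊢ <;>
      first
        | linarith
        | (have hlt : (T : ℝ) < X := lt_of_le_of_ne (by linarith) hX'.symm
           linarith)
end

section
/- Let k ≥ 2 be an integer and let p_1,…,p_q be positive integers whose sum S = Σ_{j=1}^q p_j is even. Extend the list by setting p_{q+1} = p_{q+2} = … = p_{q+k−2} = S/2. Then the index set {1,…,q+k−2} can be partitioned into k pairwise disjoint sets I_1,…,I_k with Σ_{j∈I_i} p_j = S/2 for every i ∈ {1,…,k} if and only if the index set {1,…,q} can be partitioned into two disjoint sets J_1, J_2 with Σ_{j∈J_1} p_j = Σ_{j∈J_2} p_j = S/2. -/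
open Finset

/-- The sum over a fibre of `f`, for a list extended by `m` copies of `T`, splits into the
contribution of the original entries and that of the added ones. -/
theorem sum_fiber_extend {α : Type*} [DecidableEq α] (q m T : ℕ) (p : Fin q → ℕ)
    (f : Fin (q + m) → α) (i : α) :
    ∑ j ∈ Finset.univ.filter (fun j => f j = i),
        (if h : (j : ℕ) < q then p ⟨(j : ℕ), h⟩ else T) =
      ∑ j ∈ Finset.univ.filter (fun j => f (Fin.castAdd m j) = i), p j +
        ∑ e : Fin m, if f (Fin.natAdd q e) = i then T else 0 := by
  rw [Finset.sum_filter, Fin.sum_univ_add, Finset.sum_filter]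
  simp

/-- Reduction from Partition to Partition-into-k-sets: extend the list `p₁,…,p_q`
(of total sum `2T`) by `k - 2` extra values equal to `T`.  The extended index set splits
into `k` parts of sum `T` each iff the original index set splits into two parts of sum `T`. -/
theorem partition_into_k_sets_iff (k q T : ℕ) (hk : 2 ≤ k) (p : Fin q → ℕ)
    (hp : ∀ j, 0 < p j) (hsum : ∑ j, p j = 2 * T) :
    (∃ f : Fin (q + (k - 2)) → Fin k, ∀ i : Fin k,
        ∑ j ∈ Finset.univ.filter (fun j => f j = i),
          (if h : (j : ℕ) < q then p ⟨(j : ℕ), h⟩ else T) = T) ↔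
    (∃ J : Finset (Fin q), ∑ j ∈ J, p j = T ∧ ∑ j ∈ Jᶜ, p j = T) := by
  obtain ⟨m, rfl⟩ := Nat.exists_eq_add_of_le' hk
  simp only [sum_fiber_extend]
  constructor
  · rintro ⟨f, hf⟩
    obtain ⟨a, ha⟩ : ∃ a, ∀ e : Fin m, f (Fin.natAdd q e) ≠ a := by
      by_contra! h
      have hcard := Fintype.card_le_of_surjective (fun e : Fin m => f (Fin.natAdd q e)) h
      simp at hcard
    have hJ := hf a
    simp only [ha, if_false, Finset.sum_const_zero, add_zero] at hJ
    refine ⟨_, hJ, ?_⟩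
    rw [← Finset.sum_add_sum_compl _ p, hJ] at hsum
    omega
  · rintro ⟨J, hJ, hJc⟩
    refine ⟨Fin.append (fun j => if j ∈ J then 0 else 1) (fun e => e.succ.succ), fun i => ?_⟩
    simp only [Fin.append_left, Fin.append_right]
    induction i using Fin.cases with
    | zero => simpa [Fin.succ_ne_zero] using hJ
    | succ i =>
      induction i using Fin.cases with
      | zero =>
        have hfilter : (Finset.univ.filter fun j =>
            (if j ∈ J then (0 : Fin (m + 2)) else 1) = Fin.succ 0) = Jᶜ := by
          ext j
          by_cases hj : j ∈ J <;> simp [hj]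
        rw [hfilter, hJc]
        simp [Fin.ext_iff]
      | succ e =>
        have hfilter : (Finset.univ.filter fun j =>
            (if j ∈ J then (0 : Fin (m + 2)) else 1) = e.succ.succ) = ∅ := by
          ext j
          by_cases hj : j ∈ J <;> simp [hj, Fin.ext_iff]
        simp [hfilter]
end

section
/- Let O be a finite set of items partitioned into pairwise disjoint parts F_1, F_2, {o'}, and {s_1,…,s_k}, and let c_1, c_2 be nonnegative additive cost functions on O. Write a_1 = c_1(F_1) and a_2 = c_2(F_2). Suppose x ∈ [0,1]^k satisfies the two inequalities a_1 + Σ_{j=1}^k c_1(s_j)·x_j ≤ a_2 + Σ_{j=1}^k c_2(s_j)·(1 − x_j) and a_2 + Σ_{j=1}^k c_2(s_j)·(1 − x_j) ≤ a_1 + c_1(o') + Σ_{j=1}^k c_1(s_j)·x_j, and that x_j ∈ {0,1} for all j except possibly one index t. Let E_1 = {s_j : x_j = 1} and E_2 = {s_j : j ≠ t, x_j = 0}. Define the two-agent allocation as follows: if x is integral, set A_1 = F_1 ∪ {o'} ∪ E_1 and A_2 = F_2 ∪ E_2; otherwise, if a_1 + c_1(E_1) ≥ a_2 + c_2(E_2),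 or if a_1 + c_1(E_1) < a_2 + c_2(E_2) and a_1 + c_1(E_1) + c_1(o') > a_2 + c_2(E_2), assign s_t to agent 2 (A_1 = F_1 ∪ {o'} ∪ E_1, A_2 = F_2 ∪ E_2 ∪ {s_t}); in the remaining case assign s_t to agent 1 (A_1 = F_1 ∪ {o'} ∪ E_1 ∪ {s_t}, A_2 = F_2 ∪ E_2). Then the resulting allocation (A_1, A_2) is EQ1 with respect to (c_1, c_2). -/
open Finset

/-- Equitability up to one item for a two-agent allocation `(A₁, A₂)`. -/
def EQ1Pair {ι : Type*} [DecidableEq ι] (c1 c2 : ι → ℝ) (A1 A2 : Finset ι) : Prop :=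
  (∃ S ⊆ A1, S.card ≤ 1 ∧ ∑ o ∈ A1 \ S, c1 o ≤ ∑ o ∈ A2, c2 o) ∧
  (∃ S ⊆ A2, S.card ≤ 1 ∧ ∑ o ∈ A2 \ S, c2 o ≤ ∑ o ∈ A1, c1 o)

/-- The cost of a part together with an injectively indexed family of items outside it. -/
theorem sum_union_image {ι κ : Type*} [DecidableEq ι] (F : Finset ι) (T : Finset κ)
    (s : κ → ι) (hs : Function.Injective s) (hF : ∀ j, s j ∉ F) (c : ι → ℝ) :
    ∑ o ∈ F ∪ T.image s, c o = ∑ o ∈ F, c o + ∑ j ∈ T, c (s j) := by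
  rw [Finset.sum_union, Finset.sum_image hs.injOn]
  rw [Finset.disjoint_right]
  intro o ho
  obtain ⟨j, -, rfl⟩ := Finset.mem_image.mp ho
  exact hF j

open scoped Classical in
/-- Rounding a basic feasible LP solution to an EQ1 allocation: the items are partitioned
into `F₁` (items fixed to agent 1, other than `o'`), `F₂` (items fixed to agent 2),
the item `o'` (given to agent 1), and small items `s 0, …, s (k-1)`; `x j` is the fraction of
`s j` given to agent 1, integral except possibly at index `t`.  The allocation obtained by
the described rounding rule is EQ1. -/
theorem lp_rounding_is_eq1 (ι : Type*) [Fintype ι] [DecidableEq ι] (k : ℕ)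
    (F1 F2 : Finset ι) (o' : ι) (s : Fin k → ι) (hs : Function.Injective s)
    (hF12 : Disjoint F1 F2) (ho1 : o' ∉ F1) (ho2 : o' ∉ F2)
    (hs1 : ∀ j, s j ∉ F1) (hs2 : ∀ j, s j ∉ F2) (hso : ∀ j, s j ≠ o')
    (hcover : ∀ o : ι, o ∈ F1 ∨ o ∈ F2 ∨ o = o' ∨ ∃ j, o = s j)
    (c1 c2 : ι → ℝ) (hc1 : ∀ o, 0 ≤ c1 o) (hc2 : ∀ o, 0 ≤ c2 o)
    (x : Fin k → ℝ) (hx0 : ∀ j, 0 ≤ x j) (hx1 : ∀ j, x j ≤ 1)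
    (t : Fin k) (hint : ∀ j, j ≠ t → x j = 0 ∨ x j = 1)
    (hLP1 : (∑ o ∈ F1, c1 o) + (∑ j, c1 (s j) * x j) ≤
      (∑ o ∈ F2, c2 o) + ∑ j, c2 (s j) * (1 - x j))
    (hLP2 : (∑ o ∈ F2, c2 o) + (∑ j, c2 (s j) * (1 - x j)) ≤
      (∑ o ∈ F1, c1 o) + c1 o' + ∑ j, c1 (s j) * x j) :
    let a1 := ∑ o ∈ F1, c1 o
    let a2 := ∑ o ∈ F2, c2 o
    let E1 := (Finset.univ.filter fun j => x j = 1).image s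
    let E2 := (Finset.univ.filter fun j => j ≠ t ∧ x j = 0).image s
    let cE1 := ∑ j ∈ Finset.univ.filter (fun j => x j = 1), c1 (s j)
    let cE2 := ∑ j ∈ Finset.univ.filter (fun j => j ≠ t ∧ x j = 0), c2 (s j)
    ((∀ j, x j = 0 ∨ x j = 1) →
      EQ1Pair c1 c2 (insert o' (F1 ∪ E1))
        (F2 ∪ (Finset.univ.filter fun j => x j = 0).image s)) ∧
    ((x t ≠ 0 ∧ x t ≠ 1) →
      ((a2 + cE2 ≤ a1 + cE1 ∨ (a1 + cE1 < a2 + cE2 ∧ a2 + cE2 < a1 + cE1 + c1 o')) →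
        EQ1Pair c1 c2 (insert o' (F1 ∪ E1)) (insert (s t) (F2 ∪ E2))) ∧
      ((a1 + cE1 < a2 + cE2 ∧ a1 + cE1 + c1 o' ≤ a2 + cE2) →
        EQ1Pair c1 c2 (insert (s t) (insert o' (F1 ∪ E1))) (F2 ∪ E2))) := by
  intro a1 a2 E1 E2 cE1 cE2
  have ho : o' ∉ F1 ∪ E1 := by
    simp only [E1, Finset.mem_union, Finset.mem_image, not_or, not_exists, not_and]
    exact ⟨ho1, fun j _ => hso j⟩
  have hB1 : ∑ o ∈ F1 ∪ E1, c1 o = a1 + cE1 := sum_union_image F1 _ s hs hs1 c1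
  have hB1o : ∑ o ∈ insert o' (F1 ∪ E1), c1 o = c1 o' + (a1 + cE1) := by
    rw [Finset.sum_insert ho, hB1]
  have hB2 : ∑ o ∈ F2 ∪ E2, c2 o = a2 + cE2 := sum_union_image F2 _ s hs hs2 c2
  refine ⟨fun hx => ?_, fun ⟨hxt0, hxt1⟩ => ?_⟩
  · have h1 : ∑ j, c1 (s j) * x j = cE1 := by
      simp only [cE1, Finset.sum_filter]
      refine Finset.sum_congr rfl fun j _ => ?_
      rcases hx j with h | h <;> simp [h]
    have h2 : ∑ j, c2 (s j) * (1 - x j) =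
        ∑ j ∈ Finset.univ.filter (fun j => x j = 0), c2 (s j) := by
      rw [Finset.sum_filter]
      refine Finset.sum_congr rfl fun j _ => ?_
      rcases hx j with h | h <;> simp [h]
    have hB2' := sum_union_image F2 (Finset.univ.filter fun j => x j = 0) s hs hs2 c2
    refine ⟨⟨{o'}, by simp, by simp, ?_⟩, ⟨∅, by simp, by simp, ?_⟩⟩
    · rw [Finset.sdiff_singleton_eq_erase, Finset.erase_insert ho, hB1, hB2']
      linarith
    · rw [Finset.sdiff_empty, hB1o, hB2']
      linarith
  · have h1 : ∑ j, c1 (s j) * x j = cE1 + c1 (s t) * x t := by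
      have : c1 (s t) * x t = ∑ j, if j = t then c1 (s j) * x j else 0 := by simp
      simp only [cE1]
      rw [this, Finset.sum_filter, ← Finset.sum_add_distrib]
      refine Finset.sum_congr rfl fun j _ => ?_
      by_cases hj : j = t
      · subst hj
        simp [hxt1]
      · rcases hint j hj with h | h <;> simp [h, hj]
    have h2 : ∑ j, c2 (s j) * (1 - x j) = cE2 + c2 (s t) * (1 - x t) := by
      have : c2 (s t) * (1 - x t) = ∑ j, if j = t then c2 (s j) * (1 - x j) else 0 := by simp
      simp only [cE2]
      rw [this, Finset.sum_filter, ← Finset.sum_add_distrib]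
      refine Finset.sum_congr rfl fun j _ => ?_
      by_cases hj : j = t
      · subst hj
        simp
      · rcases hint j hj with h | h <;> simp [h, hj]
    have ht2 : s t ∉ F2 ∪ E2 := by
      simp only [E2, Finset.mem_union, Finset.mem_image, Finset.mem_filter, not_or, not_exists,
        not_and]
      exact ⟨hs2 t, fun j hj h => hj.2.1 (hs h)⟩
    have ht1 : s t ∉ insert o' (F1 ∪ E1) := by
      simp only [E1, Finset.mem_insert, Finset.mem_union, Finset.mem_image, Finset.mem_filter,
        not_or, not_exists, not_and]
      exact ⟨hso t, hs1 t, fun j hj h => hxt1 (hs h ▸ hj.2)⟩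
    have hp0 : 0 ≤ c1 (s t) * x t := mul_nonneg (hc1 _) (hx0 t)
    have hp1 : c1 (s t) * x t ≤ c1 (s t) := mul_le_of_le_one_right (hc1 _) (hx1 t)
    have hq0 : 0 ≤ c2 (s t) * (1 - x t) := mul_nonneg (hc2 _) (by linarith [hx1 t])
    have hq1 : c2 (s t) * (1 - x t) ≤ c2 (s t) :=
      mul_le_of_le_one_right (hc2 _) (by linarith [hx0 t])
    have ho0 := hc1 o'
    refine ⟨fun h => ⟨⟨{o'}, by simp, by simp, ?_⟩, ⟨{s t}, by simp, by simp, ?_⟩⟩,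
      fun h => ⟨⟨{s t}, by simp, by simp, ?_⟩, ⟨∅, by simp, by simp, ?_⟩⟩⟩
    · rw [Finset.sdiff_singleton_eq_erase, Finset.erase_insert ho, hB1,
        Finset.sum_insert ht2, hB2]
      linarith
    · rw [Finset.sdiff_singleton_eq_erase, Finset.erase_insert ht2, hB1o, hB2]
      rcases h with h | h <;> linarith
    · rw [Finset.sdiff_singleton_eq_erase, Finset.erase_insert ht1, hB1o, hB2]
      linarith
    · rw [Finset.sdiff_empty, Finset.sum_insert ht1, hB1o, hB2]
      linarith
end
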